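/- arXiv:2209.08926 — 4 statements merged into one kernel-verified Lean document; each statement's English description precedes it below -/
import Mathlib

section
/- If R(P) = {0 = a_0 < a_1 < ... < a_k} is the irreducible period set of a string of length n, then k ≤ log₂(n). -/
def IsPeriod {α : Type*} (n : ℕ) (u : Fin n → α) (p : ℕ) : Prop :=
  p < n ∧ ∀ (i : ℕ) (h : i + p < n),
    u ⟨i, Nat.lt_of_le_of_lt (Nat.le_add_right i p) h⟩ = u ⟨i + p, h⟩

/-- Generators of the forward closure: smallest superset of `S` closed under the
forward propagation rule. -/
inductive FCgen (n : ℕ) (S : Set ℕ) : ℕ → Prop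
  | base {p : ℕ} : p ∈ S → FCgen n S p
  | step {p q k : ℕ} : FCgen n S p → FCgen n S q → p ≤ q →
      p + k * (q - p) < n → FCgen n S (p + k * (q - p))

/-- The forward closure of a set `S ⊆ {0,…,n-1}`. -/
def FC (n : ℕ) (S : Set ℕ) : Set ℕ := {m | FCgen n S m}

/-- The period set of a string. -/
def PeriodSet {α : Type*} (n : ℕ) (u : Fin n → α) : Set ℕ := {p | IsPeriod n u p}

/-- `R` is the irreducible period set of `P`: a minimal subset of `P` whose
forward closure is `P`. -/
def IsIrred (n : ℕ) (P R : Set ℕ) : Prop :=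
  R ⊆ P ∧ FC n R = P ∧ ∀ R' ⊆ R, FC n R' = P → R' = R

open Classical in
/-- predecessor in `P` -/
noncomputable def prd (P : Set ℕ) (q : ℕ) : ℕ := Nat.findGreatest (fun x => x ∈ P) (q - 1)

/-- gap before `q` in `P` -/
noncomputable def gp (P : Set ℕ) (q : ℕ) : ℕ := q - prd P q

theorem prd_mem {P : Set ℕ} (h0 : 0 ∈ P) (q : ℕ) : prd P q ∈ P := by
  classical
  exact Nat.findGreatest_spec (P := fun x => x ∈ P) (Nat.zero_le (q - 1)) h0

theorem prd_lt (P : Set ℕ) {q : ℕ} (hq : 0 < q) : prd P q < q := by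
  classical
  have : prd P q ≤ q - 1 := Nat.findGreatest_le _
  omega

theorem le_prd {P : Set ℕ} {p q : ℕ} (hp : p ∈ P) (h : p < q) : p ≤ prd P q := by
  classical
  exact Nat.le_findGreatest (P := fun x => x ∈ P) (by omega) hp

section
variable {P : Set ℕ} {n : ℕ}

theorem gp_step (h0 : 0 ∈ P) (hn : ∀ p ∈ P, p < n)
    (hc : ∀ p ∈ P, ∀ q ∈ P, p ≤ q → p + 2 * (q - p) < n → p + 2 * (q - p) ∈ P)
    {q : ℕ} (hq : q ∈ P) (hpos : 0 < prd P q) : gp P q ≤ gp P (prd P q) := by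
  have hq0 : 0 < q := by
    by_contra h
    classical
    have : q = 0 := by omega
    subst this
    have : prd P 0 ≤ 0 - 1 := Nat.findGreatest_le _
    omega
  have h1 := prd_lt P hq0
  have h2 := prd_lt P hpos
  have h3 := hc _ (prd_mem h0 (prd P q)) _ (prd_mem h0 q) h2.le
  have h4 := hn q hq
  unfold gp
  by_contra h
  have h5 := le_prd (h3 (by omega)) (q := q) (by omega)
  omega

theorem gp_anti (h0 : 0 ∈ P) (hn : ∀ p ∈ P, p < n)
    (hc : ∀ p ∈ P, ∀ q ∈ P, p ≤ q → p + 2 * (q - p) < n → p + 2 * (q - p) ∈ P)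
    {p : ℕ} (hp : p ∈ P) (hp0 : 0 < p) :
    ∀ q, q ∈ P → p ≤ q → gp P q ≤ gp P p := by
  intro q
  induction q using Nat.strong_induction_on with
  | _ q ih =>
    intro hq hpq
    rcases hpq.eq_or_lt with rfl | hlt
    · exact le_rfl
    · have h1 := le_prd hp hlt
      exact (gp_step h0 hn hc hq (by omega)).trans
        (ih _ (prd_lt P (by omega)) (prd_mem h0 q) h1)

theorem gp_sum {x : ℕ} (hx : x ∈ P) :
    ∀ y, ∀ I : Finset ℕ, x ≤ y → (∀ q ∈ I, q ∈ P ∧ x < q ∧ q ≤ y) →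
      ∑ q ∈ I, gp P q ≤ y - x := by
  intro y
  induction y using Nat.strong_induction_on with
  | _ y ih =>
    intro I hxy hI
    rcases hxy.eq_or_lt with rfl | hlt
    · have : I = ∅ := by
        apply Finset.eq_empty_of_forall_notMem
        intro q hq
        have := hI q hq
        omega
      simp [this]
    · by_cases hy : y ∈ I
      · have h1 := le_prd hx hlt
        have h2 := prd_lt P (q := y) (by omega)
        have h3 := ih _ h2 (I.erase y) h1 (by
          intro q hq
          rw [Finset.mem_erase] at hq
          have h4 := hI q hq.2
          refine ⟨h4.1, h4.2.1, le_prd h4.1 ?_⟩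
          have := hq.1
          omega)
        rw [← Finset.add_sum_erase I _ hy]
        unfold gp at *
        omega
      · have := ih (y - 1) (by omega) I (by omega) (by
          intro q hq
          have h4 := hI q hq
          have : q ≠ y := by rintro rfl; exact hy hq
          exact ⟨h4.1, h4.2.1, by omega⟩)
        omega

theorem gp_main (h0 : 0 ∈ P) (hn : ∀ p ∈ P, p < n)
    (hc : ∀ p ∈ P, ∀ q ∈ P, p ≤ q → p + 2 * (q - p) < n → p + 2 * (q - p) ∈ P)
    (I : Finset ℕ) (hI : ∀ q ∈ I, q ∈ P ∧ 0 < q)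
    (hirr : ∀ p ∈ P, ∀ q ∈ P, p < q → p + 2 * (q - p) ∉ I) :
    ∀ g, ∀ z ∈ P, 0 < z → gp P z = g → ∑ q ∈ I with gp P q < g, gp P q < g := by
  classical
  intro g
  induction g using Nat.strong_induction_on with
  | _ d ih =>
    intro z hz hz0 hzd
    -- last element with gap d
    obtain ⟨m, ⟨hmP, hm0, hmd⟩, hmax⟩ :
        ∃ m, (m ∈ P ∧ 0 < m ∧ gp P m = d) ∧ ∀ w, w ∈ P → 0 < w → gp P w = d → w ≤ m := by
      refine ⟨Nat.findGreatest (fun w => w ∈ P ∧ 0 < w ∧ gp P w = d) n,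
        Nat.findGreatest_spec (P := fun w => w ∈ P ∧ 0 < w ∧ gp P w = d) (hn z hz).le
          ⟨hz, hz0, hzd⟩, ?_⟩
      intro w h1 h2 h3
      exact Nat.le_findGreatest (P := fun w => w ∈ P ∧ 0 < w ∧ gp P w = d) (hn w h1).le
        ⟨h1, h2, h3⟩
    have hdpos : 0 < d := by
      have := prd_lt P hm0
      unfold gp at hmd
      omega
    have hgt : ∀ q ∈ I, gp P q < d → m < q := by
      intro q hq hqd
      by_contra h
      have := gp_anti h0 hn hc (hI q hq).1 (hI q hq).2 m hmP (by omega)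
      omega
    have hpm := prd_lt P hm0
    have hmt : prd P m + 2 * (m - prd P m) = m + d := by
      unfold gp at hmd
      omega
    by_cases ht : m + d < n
    · have htP : m + d ∈ P := by
        have := hc _ (prd_mem h0 m) _ hmP hpm.le
        rw [hmt] at this
        exact this ht
      have htI : m + d ∉ I := by
        have := hirr _ (prd_mem h0 m) _ hmP hpm
        rwa [hmt] at this
      have hs1 := le_prd hmP (q := m + d) (by omega)
      have hs2 := prd_lt P (q := m + d) (by omega)
      have hgt' : gp P (m + d) < d := by
        have h1 : gp P (m + d) ≠ d := by
          intro h
          have := hmax _ htP (by omega) h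
          omega
        unfold gp at *
        omega
      have hF := ih _ hgt' _ htP (by omega) rfl
      have hA := gp_sum hmP (prd P (m + d))
        (I.filter (fun q => m < q ∧ q ≤ prd P (m + d))) hs1 (by
          intro q hq
          rw [Finset.mem_filter] at hq
          exact ⟨(hI q hq.1).1, hq.2⟩)
      have hsub : (I.filter (fun q => gp P q < d)) ⊆
          (I.filter (fun q => m < q ∧ q ≤ prd P (m + d))) ∪
          (I.filter (fun q => gp P q < gp P (m + d))) := by
        intro q hq
        rw [Finset.mem_filter] at hq
        obtain ⟨hqI, hqd⟩ := hq
        have hqP := (hI q hqI).1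
        have hmq := hgt q hqI hqd
        rw [Finset.mem_union, Finset.mem_filter, Finset.mem_filter]
        rcases lt_trichotomy q (m + d) with h | h | h
        · exact Or.inl ⟨hqI, hmq, le_prd hqP h⟩
        · subst h; exact absurd hqI htI
        · right
          refine ⟨hqI, ?_⟩
          have h1 := gp_anti h0 hn hc htP (by omega) q hqP h.le
          refine lt_of_le_of_ne h1 ?_
          intro heq
          have h2 := le_prd htP h
          have h3 := gp_anti h0 hn hc htP (by omega) _ (prd_mem h0 q) h2
          have h4 := gp_step h0 hn hc hqP (by omega)
          have h5 := prd_lt P (q := q) (by omega)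
          have h6 := prd_lt P (q := prd P q) (by omega)
          apply hirr _ (prd_mem h0 (prd P q)) _ (prd_mem h0 q) h6
          have : prd P (prd P q) + 2 * (prd P q - prd P (prd P q)) = q := by
            have h7 : gp P q = gp P (prd P q) := by omega
            unfold gp at h7
            omega
          rwa [this]
      have hB := Finset.sum_le_sum_of_subset (f := gp P) hsub
      have hC := Finset.sum_union_inter (f := gp P)
        (s₁ := I.filter (fun q => m < q ∧ q ≤ prd P (m + d)))
        (s₂ := I.filter (fun q => gp P q < gp P (m + d)))
      have hD : gp P (m + d) = m + d - prd P (m + d) := rfl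
      omega
    · have hmn := hn m hmP
      have hA := gp_sum hmP (n - 1) (I.filter (fun q => gp P q < d)) (by omega) (by
        intro q hq
        rw [Finset.mem_filter] at hq
        have h1 := hn q (hI q hq.1).1
        exact ⟨(hI q hq.1).1, hgt q hq.1 hq.2, by omega⟩)
      omega

theorem gp_card (h0 : 0 ∈ P) (hn : ∀ p ∈ P, p < n)
    (hc : ∀ p ∈ P, ∀ q ∈ P, p ≤ q → p + 2 * (q - p) < n → p + 2 * (q - p) ∈ P)
    (I : Finset ℕ) (hI : ∀ q ∈ I, q ∈ P ∧ 0 < q)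
    (hirr : ∀ p ∈ P, ∀ q ∈ P, p < q → p + 2 * (q - p) ∉ I) :
    2 ^ I.card ≤ n := by
  have key : ∀ J : Finset ℕ, J ⊆ I → 2 ^ J.card ≤ 1 + ∑ q ∈ J, gp P q := by
    intro J
    induction J using Finset.induction_on_min with
    | empty => simp
    | insert z s hz ih =>
      intro hJ
      have hzs : z ∉ s := fun h => lt_irrefl _ (hz z h)
      have hs : s ⊆ I := fun x hx => hJ (Finset.mem_insert_of_mem hx)
      have hzI := hI z (hJ (Finset.mem_insert_self _ _))
      have h1 := ih hs
      have h2 := gp_main h0 hn hc I hI hirr _ z hzI.1 hzI.2 rfl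
      have h3 : s ⊆ I.filter (fun q => gp P q < gp P z) := by
        intro q hq
        rw [Finset.mem_filter]
        have hqI := hI q (hs hq)
        have hlt := hz q hq
        refine ⟨hs hq, lt_of_le_of_ne (gp_anti h0 hn hc hzI.1 hzI.2 q hqI.1 hlt.le) ?_⟩
        intro heq
        have h2 := le_prd hzI.1 hlt
        have h3 := gp_anti h0 hn hc hzI.1 hzI.2 _ (prd_mem h0 q) h2
        have h4 := gp_step h0 hn hc hqI.1 (by omega)
        have h5 := prd_lt P (q := q) (by omega)
        have h6 := prd_lt P (q := prd P q) (by omega)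
        apply hirr _ (prd_mem h0 (prd P q)) _ (prd_mem h0 q) h6
        have : prd P (prd P q) + 2 * (prd P q - prd P (prd P q)) = q := by
          have h7 : gp P q = gp P (prd P q) := by omega
          unfold gp at h7
          omega
        rw [this]
        exact hs hq
      have h4 := Finset.sum_le_sum_of_subset (f := gp P) h3
      rw [Finset.card_insert_of_notMem hzs, Finset.sum_insert hzs, pow_succ]
      omega
  have h1 := key I subset_rfl
  have hn0 := hn 0 h0
  have h2 := gp_sum h0 (n - 1) I (by omega) (by
    intro q hq
    have := hI q hq
    have := hn q this.1
    exact ⟨(hI q hq).1, (hI q hq).2, by omega⟩)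
  omega

end

theorem FCgen_erase {n : ℕ} {R : Set ℕ} {z x : ℕ} (h : FCgen n R x) :
    x < z → FCgen n (R \ {z}) x := by
  induction h with
  | base hp =>
    intro hx
    exact .base ⟨hp, by simp; omega⟩
  | @step p q k _ _ hpq hlt ih1 ih2 =>
    intro hx
    rcases Nat.eq_zero_or_pos k with rfl | hk
    · simpa using ih1 (by omega)
    · have : q - p ≤ k * (q - p) := Nat.le_mul_of_pos_left _ hk
      exact .step (ih1 (by omega)) (ih2 (by omega)) hpq hlt

theorem FCgen_mono_sub {n : ℕ} {R S : Set ℕ} (hRS : ∀ r ∈ R, FCgen n S r) {x : ℕ}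
    (h : FCgen n R x) : FCgen n S x := by
  induction h with
  | base hp => exact hRS _ hp
  | step _ _ hpq hlt ih1 ih2 => exact .step ih1 ih2 hpq hlt

theorem irred_card_le_log {α : Type*} {n k : ℕ} (u : Fin n → α) (a : Fin (k + 1) → ℕ)
    (ha : StrictMono a) (ha0 : a 0 = 0)
    (hirr : IsIrred n (PeriodSet n u) (Set.range a)) :
    (k : ℝ) ≤ Real.logb 2 n := by
  classical
  obtain ⟨hsub, hFC, hmin⟩ := hirr
  have hn : ∀ p ∈ PeriodSet n u, p < n := fun p hp => hp.1
  generalize PeriodSet n u = P at *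
  have h0 : 0 ∈ P := hsub ⟨0, ha0⟩
  have hc : ∀ p ∈ P, ∀ q ∈ P, p ≤ q → p + 2 * (q - p) < n → p + 2 * (q - p) ∈ P := by
    intro p hp q hq hpq hlt
    rw [← hFC] at hp hq ⊢
    exact FCgen.step hp hq hpq hlt
  have hI : ∀ q ∈ (Finset.univ.image a).erase 0, q ∈ P ∧ 0 < q := by
    intro q hq
    rw [Finset.mem_erase, Finset.mem_image] at hq
    obtain ⟨hq0, i, -, hi⟩ := hq
    exact ⟨hsub ⟨i, hi⟩, Nat.pos_of_ne_zero hq0⟩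
  have hir : ∀ p ∈ P, ∀ q ∈ P, p < q →
      p + 2 * (q - p) ∉ (Finset.univ.image a).erase 0 := by
    intro p hp q hq hpq hmem
    have hzP := (hI _ hmem).1
    have hzR : p + 2 * (q - p) ∈ Set.range a := by
      rw [Finset.mem_erase, Finset.mem_image] at hmem
      obtain ⟨_, i, -, hi⟩ := hmem
      exact ⟨i, hi⟩
    rw [← hFC] at hp hq
    have hz : FCgen n (Set.range a \ {p + 2 * (q - p)}) (p + 2 * (q - p)) :=
      .step (FCgen_erase hp (by omega)) (FCgen_erase hq (by omega)) hpq.le (hn _ hzP)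
    have hE := hmin (Set.range a \ {p + 2 * (q - p)}) Set.diff_subset (by
      rw [← hFC]
      ext x
      constructor
      · intro hx
        exact FCgen_mono_sub (fun r hr => .base hr.1) hx
      · intro hx
        refine FCgen_mono_sub (fun r hr => ?_) hx
        by_cases h : r = p + 2 * (q - p)
        · rw [h]; exact hz
        · exact .base ⟨hr, h⟩)
    rw [← hE] at hzR
    exact hzR.2 rfl
  have hcard := gp_card h0 hn hc _ hI hir
  rw [Finset.card_erase_of_mem (Finset.mem_image.2 ⟨0, Finset.mem_univ _, ha0⟩),
    Finset.card_image_of_injective _ ha.injective, Finset.card_univ, Fintype.card_fin,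
    Nat.add_sub_cancel] at hcard
  have hn0 := hn 0 h0
  rw [Real.le_logb_iff_rpow_le (by norm_num) (by exact_mod_cast hn0), Real.rpow_natCast]
  exact_mod_cast hcard
end

section
/- For all integers n ≥ 2, the number κ_n of distinct autocorrelations of strings of length n satisfies ln(κ_n)/ln²(n) ≤ 1/(2 ln 2) + 3/(2 ln n); equivalently, κ_n ≤ exp(ln²(n)/(2 ln 2) + (3/2) ln n). -/
/-- The number of distinct period sets (equivalently autocorrelations) of
binary strings of length `n`. -/
noncomputable def kappa (n : ℕ) : ℕ :=
  Set.ncard {S : Set ℕ | ∃ u : Fin n → Bool, S = PeriodSet n u}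

/-- Abstract closure properties of period sets of strings of length `M`. -/
def PGood (M : ℕ) (P : Set ℕ) : Prop :=
  (∀ p ∈ P, p < M) ∧ (0 < M → 0 ∈ P) ∧
  (∀ a b, a ∈ P → b ∈ P → a ≤ b → b + (b - a) < M → b + (b - a) ∈ P) ∧
  (∀ a b c, a ∈ P → b ∈ P → c ∈ P → a ≤ b → b ≤ c → b + c ≤ M + a → a + (c - b) ∈ P)

/-- Good sets which contain the (nontrivial) known period `β`. -/
def PFam (M β : ℕ) : Set (Set ℕ) := {P | PGood M P ∧ (β < M → β ∈ P)}

lemma pGood_periodSet {n : ℕ} (u : Fin n → Bool) : PGood n (PeriodSet n u) := by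
  refine ⟨fun p hp => hp.1, fun h => ⟨h, fun i hi => rfl⟩, ?_, ?_⟩
  · intro a b ha hb hab hlt
    refine ⟨hlt, fun i hi => ?_⟩
    have h1 := hb.2 i (by omega)
    have h2 := ha.2 (i + (b - a)) (by omega)
    have h3 := hb.2 (i + (b - a)) (by omega)
    have e2 : i + (b - a) + a = i + b := by omega
    have e3 : i + (b - a) + b = i + (b + (b - a)) := by omega
    simp only [e2] at h2
    simp only [e3] at h3
    rw [h1, ← h2, h3]
  · intro a b c ha hb hc hab hbc hle
    have hcn := hc.1
    refine ⟨by omega, fun i hi => ?_⟩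
    by_cases hic : i + c < n
    · have h1 := hc.2 i hic
      have h2 := hb.2 (i + (c - b)) (by omega)
      have h3 := ha.2 (i + (c - b)) (by omega)
      have e2 : i + (c - b) + b = i + c := by omega
      have e3 : i + (c - b) + a = i + (a + (c - b)) := by omega
      simp only [e2] at h2
      simp only [e3] at h3
      rw [h1, ← h2, h3]
    · have h1 := ha.2 i (by omega)
      have h2 := hb.2 (i + a - b) (by omega)
      have h3 := hc.2 (i + a - b) (by omega)
      have e2 : i + a - b + b = i + a := by omega
      have e3 : i + a - b + c = i + (a + (c - b)) := by omega
      simp only [e2] at h2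
      simp only [e3] at h3
      rw [h1, ← h2, h3]

lemma pFam_finite (M β : ℕ) : (PFam M β).Finite := by
  apply (Set.Finite.finite_subsets (Set.finite_Iio M)).subset
  intro P hP p hp
  exact hP.1.1 p hp

/-- Reconstruction map. -/
def pGlue (β y : ℕ) (Q : Set ℕ) : Set ℕ := {m | (m < y ∧ β ∣ m) ∨ (y ≤ m ∧ m - y ∈ Q)}

/-- The new known period. -/
def pNext (M β y : ℕ) : ℕ := min (y % β) (min (β - y % β) (M - y))

lemma pGood_shift {M y : ℕ} {P : Set ℕ} (h : PGood M P) (hy : y ∈ P) :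
    PGood (M - y) {m | y + m ∈ P} := by
  obtain ⟨h1, h2, h3, h4⟩ := h
  refine ⟨fun p hp => ?_, fun _ => by simpa using hy, ?_, ?_⟩
  · have := h1 _ hp
    omega
  · intro a b ha hb hab hlt
    have := h3 _ _ ha hb (by omega) (by omega)
    have e : y + b + (y + b - (y + a)) = y + (b + (b - a)) := by omega
    rw [e] at this
    exact this
  · intro a b c ha hb hc hab hbc hle
    have hcn := h1 _ hc
    have := h4 _ _ _ ha hb hc (by omega) (by omega) (by omega)
    have e : y + a + (y + c - (y + b)) = y + (a + (c - b)) := by omega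
    rw [e] at this
    exact this

lemma pGood_mul {M β : ℕ} {P : Set ℕ} (h : PGood M P) (hM : 0 < M) (hβ : β < M → β ∈ P) (k : ℕ)
    (hk : k * β < M) : k * β ∈ P := by
  induction k using Nat.strong_induction_on with
  | _ k ih =>
    match k, hk, ih with
    | 0, _, _ => simpa using h.2.1 hM
    | 1, hk, _ => simpa using hβ (by simpa using hk)
    | k + 2, hk, ih =>
      have e1 : (k + 1) * β = k * β + β := by ring
      have e2 : (k + 2) * β = k * β + β + β := by ring
      have a1 := ih k (by omega) (by omega)
      have a2 := ih (k + 1) (by omega) (by omega)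
      have := h.2.2.1 _ _ a1 a2 (by omega) (by omega)
      have e : (k + 1) * β + ((k + 1) * β - k * β) = (k + 2) * β := by omega
      rwa [e] at this

lemma pFam_decomp {M β : ℕ} (h1 : 1 ≤ β) (hM : β ≤ M) :
    PFam M β ⊆ {{m | m < M ∧ β ∣ m}} ∪
      ⋃ y ∈ (Finset.Ioo 0 β ∪ Finset.Ioo (M - β) M).filter (fun y => ¬ β ∣ y),
        pGlue β y '' PFam (M - y) (pNext M β y) := by
  classical
  rintro P ⟨hP, hβ⟩
  have hmul : ∀ m, m < M → β ∣ m → m ∈ P := by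
    rintro m hm ⟨k, rfl⟩
    rw [mul_comm] at hm ⊢
    exact pGood_mul hP (by omega) hβ k hm
  by_cases hex : ∃ y, y ∈ P ∧ ¬ β ∣ y
  · right
    obtain ⟨hyP, hyd⟩ := Nat.find_spec hex
    have hmin : ∀ m, m < Nat.find hex → m ∈ P → β ∣ m := by
      intro m hm hmP
      by_contra hc
      exact Nat.find_min hex hm ⟨hmP, hc⟩
    generalize Nat.find hex = y at hyP hyd hmin
    have hyM := hP.1 y hyP
    have hy0 : y ≠ 0 := by rintro rfl; exact hyd (dvd_zero _)
    have hyβ : y ≠ β := by rintro rfl; exact hyd dvd_rfl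
    have hmod0 : y % β ≠ 0 := fun h => hyd (Nat.dvd_of_mod_eq_zero h)
    have hmodlt : y % β < β := Nat.mod_lt _ h1
    simp only [Set.mem_iUnion]
    refine ⟨y, ?_, {m | y + m ∈ P}, ⟨pGood_shift hP hyP, ?_⟩, ?_⟩
    · simp only [Finset.mem_filter, Finset.mem_union, Finset.mem_Ioo]
      refine ⟨?_, hyd⟩
      by_cases hlt : y < β
      · left; omega
      · right
        refine ⟨?_, hyM⟩
        by_contra hle
        have h0 : 0 ∈ P := hP.2.1 (by omega)
        have := hP.2.2.2 0 β y h0 (hβ (by omega)) hyP (by omega) (by omega) (by omega)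
        have hd := hmin _ (by omega) this
        rw [zero_add] at hd
        exact hyd ((Nat.dvd_sub_iff_left (by omega) dvd_rfl).1 hd)
    · intro hlt
      have hdm := Nat.div_add_mod y β
      have htP : β * (y / β) ∈ P := hmul _ (by omega) (dvd_mul_right _ _)
      show y + pNext M β y ∈ P
      unfold pNext at hlt ⊢
      rcases le_total (y % β) (min (β - y % β) (M - y)) with h | h
      · rw [min_eq_left h] at hlt ⊢
        have := hP.2.2.1 _ _ htP hyP (by omega) (by omega)
        have e : y + (y - β * (y / β)) = y + y % β := by omega
        rwa [e] at this
      · rw [min_eq_right h] at hlt ⊢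
        rcases le_total (β - y % β) (M - y) with hA | hA
        · rw [min_eq_left hA] at hlt ⊢
          have e : y + (β - y % β) = β * (y / β + 1) := by rw [mul_add]; omega
          rw [e]
          exact hmul _ (by omega) (dvd_mul_right _ _)
        · rw [min_eq_right hA] at hlt
          omega
    · ext m
      simp only [pGlue, Set.mem_ofPred_eq]
      constructor
      · rintro (⟨ha, hb⟩ | ⟨ha, hb⟩)
        · exact hmul m (by omega) hb
        · rwa [Nat.add_sub_cancel' ha] at hb
      · intro hm
        by_cases hmy : m < y
        · exact Or.inl ⟨hmy, hmin m hmy hm⟩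
        · right
          refine ⟨by omega, ?_⟩
          rwa [Nat.add_sub_cancel' (by omega)]
  · left
    push Not at hex
    rw [Set.mem_singleton_iff]
    ext m
    exact ⟨fun hm => ⟨hP.1 m hm, hex m hm⟩, fun hm => hmul m hm.1 hm.2⟩

lemma ncard_biUnion_le_real {α : Type*} (Y : Finset ℕ) (T : ℕ → Set α) (c : ℝ)
    (h : ∀ y ∈ Y, ((T y).ncard : ℝ) ≤ c) :
    ((⋃ y ∈ Y, T y).ncard : ℝ) ≤ Y.card * c := by
  classical
  induction Y using Finset.induction_on with
  | empty => simp
  | insert a s ha ih =>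
    rw [Finset.set_biUnion_insert, Finset.card_insert_of_notMem ha]
    have h1 := ih (fun y hy => h y (Finset.mem_insert_of_mem hy))
    have h2 := h a (Finset.mem_insert_self _ _)
    have h3 : ((T a ∪ ⋃ y ∈ s, T y).ncard : ℝ) ≤ (T a).ncard + (⋃ y ∈ s, T y).ncard := by
      exact_mod_cast Set.ncard_union_le _ _
    push_cast
    linarith

/-- The bounding function. -/
noncomputable def gB (x : ℝ) : ℝ :=
  Real.exp (Real.log x ^ 2 / (2 * Real.log 2) + 3 / 2 * Real.log x)

lemma gB_mono {x y : ℝ} (hx : 1 ≤ x) (hxy : x ≤ y) : gB x ≤ gB y := by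
  unfold gB
  have h0 := Real.log_nonneg hx
  have h1 := Real.log_le_log (by linarith) hxy
  have h2 : 0 < Real.log 2 := Real.log_pos (by norm_num)
  gcongr

lemma gB_one : gB 1 = 1 := by simp [gB]

lemma gB_half {x : ℝ} (hx : 0 < x) : gB x = 2 * x * gB (x / 2) := by
  unfold gB
  have h2 : 0 < Real.log 2 := Real.log_pos (by norm_num)
  have : 2 * x = Real.exp (Real.log 2 + Real.log x) := by
    rw [Real.exp_add, Real.exp_log hx, Real.exp_log (by norm_num)]
  rw [this, ← Real.exp_add, Real.log_div hx.ne' (by norm_num)]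
  congr 1
  field_simp
  ring

lemma pFam_card (β : ℕ) : ∀ M, 1 ≤ β → β ≤ M → ((PFam M β).ncard : ℝ) ≤ gB β := by
  induction β using Nat.strong_induction_on with
  | _ β ih =>
    intro M h1 hM
    set Y := (Finset.Ioo 0 β ∪ Finset.Ioo (M - β) M).filter (fun y => ¬ β ∣ y) with hY
    have hfin : (⋃ y ∈ Y, pGlue β y '' PFam (M - y) (pNext M β y)).Finite :=
      Set.Finite.biUnion (Finset.finite_toSet Y) (fun y _ => (pFam_finite _ _).image _)
    have hle : ((PFam M β).ncard : ℝ) ≤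
        1 + (⋃ y ∈ Y, pGlue β y '' PFam (M - y) (pNext M β y)).ncard := by
      have a := Set.ncard_le_ncard (pFam_decomp h1 hM) ((Set.finite_singleton _).union hfin)
      have b := a.trans (Set.ncard_union_le _ _)
      rw [Set.ncard_singleton] at b
      exact_mod_cast b
    have hc : Y.card ≤ 2 * (β - 1) := by
      refine (Finset.card_filter_le _ _).trans ((Finset.card_union_le _ _).trans ?_)
      simp only [Nat.card_Ioo]
      omega
    have hb := ncard_biUnion_le_real Y (fun y => pGlue β y '' PFam (M - y) (pNext M β y))
      (gB (β / 2)) (by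
        intro y hy
        simp only [hY, Finset.mem_filter, Finset.mem_union, Finset.mem_Ioo] at hy
        obtain ⟨hy, hyd⟩ := hy
        have hmod0 : y % β ≠ 0 := fun h => hyd (Nat.dvd_of_mod_eq_zero h)
        have hmodlt : y % β < β := Nat.mod_lt _ h1
        have hn1 : 1 ≤ pNext M β y := by unfold pNext; omega
        have hn2 : 2 * pNext M β y ≤ β := by unfold pNext; omega
        have hn3 : pNext M β y ≤ M - y := by unfold pNext; omega
        have a := ih (pNext M β y) (by omega) (M - y) hn1 hn3
        have b : ((pGlue β y '' PFam (M - y) (pNext M β y)).ncard : ℝ) ≤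
            (PFam (M - y) (pNext M β y)).ncard := by
          exact_mod_cast Set.ncard_image_le (pFam_finite _ _)
        refine b.trans (a.trans (gB_mono (by exact_mod_cast hn1) ?_))
        have : (2 : ℝ) * pNext M β y ≤ β := by exact_mod_cast hn2
        linarith)
    have hβ0 : (1 : ℝ) ≤ β := by exact_mod_cast h1
    rcases Nat.lt_or_ge β 2 with h | h
    · have : β = 1 := by omega
      have hz : (Y.card : ℝ) = 0 := by
        have : Y.card = 0 := by omega
        exact_mod_cast this
      rw [hz, zero_mul] at hb
      rw [this] at hle hb ⊢
      simp only [Nat.cast_one, gB_one]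
      linarith
    · have hβ2 : (2 : ℝ) ≤ β := by exact_mod_cast h
      have hg : 1 ≤ gB ((β : ℝ) / 2) := by
        rw [← gB_one]
        exact gB_mono le_rfl (by linarith)
      have hcR : (Y.card : ℝ) ≤ 2 * (β - 1) := by
        have : ((2 * (β - 1) : ℕ) : ℝ) = 2 * (β - 1) := by
          push_cast [Nat.cast_sub h1]; ring
        rw [← this]
        exact_mod_cast hc
      rw [gB_half (by linarith)]
      have := mul_le_mul_of_nonneg_right hcR (by linarith : 0 ≤ gB ((β : ℝ) / 2))
      nlinarith

theorem kappa_upper_bound {n : ℕ} (hn : 2 ≤ n) :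
    Real.log (kappa n) / (Real.log n) ^ 2 ≤
      1 / (2 * Real.log 2) + 3 / (2 * Real.log n) := by
  have hk : (kappa n : ℝ) ≤ gB n := by
    refine le_trans ?_ (pFam_card n n (by omega) le_rfl)
    unfold kappa
    have : {S : Set ℕ | ∃ u : Fin n → Bool, S = PeriodSet n u} ⊆ PFam n n := by
      rintro S ⟨u, rfl⟩
      exact ⟨pGood_periodSet u, fun h => absurd h (lt_irrefl _)⟩
    exact_mod_cast Set.ncard_le_ncard this (pFam_finite _ _)
  have hl2 : 0 < Real.log 2 := Real.log_pos (by norm_num)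
  have hn2 : (2 : ℝ) ≤ n := by exact_mod_cast hn
  have hl : 0 < Real.log n := Real.log_pos (by linarith)
  have hlog : Real.log (kappa n) ≤ Real.log n ^ 2 / (2 * Real.log 2) + 3 / 2 * Real.log n := by
    rcases Nat.eq_zero_or_pos (kappa n) with h0 | h0
    · rw [h0]
      simp only [Nat.cast_zero, Real.log_zero]
      positivity
    · have := Real.log_le_log (by exact_mod_cast h0) hk
      rwa [gB, Real.log_exp] at this
  rw [div_le_iff₀ (by positivity)]
  refine hlog.trans (le_of_eq ?_)
  field_simp
end

section
/- The sequence ln(κ_n)/ln²(n) converges to 1/(2 ln 2) as n → ∞. -/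
/-- `p` is a period of the prefix of length `L` of `u` (every `p ≥ L` is one). -/
def KPer (u : ℕ → Bool) (L p : ℕ) : Prop := ∀ i, i + p < L → u i = u (i + p)

def KA (u : ℕ → Bool) (L : ℕ) : Set ℕ := {p | KPer u L p}

/-- `{0} ∪ (q + A)` -/
def KShift (q : ℕ) (A : Set ℕ) : Set ℕ := {p | p = 0 ∨ (q ≤ p ∧ p - q ∈ A)}

theorem KPer.zero (u : ℕ → Bool) (L : ℕ) : KPer u L 0 := fun _ _ => rfl

theorem KPer.big (u : ℕ → Bool) {L p : ℕ} (h : L ≤ p) : KPer u L p := fun i hi => by omega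

theorem KPer.restrict {u : ℕ → Bool} {L L' p : ℕ} (h : KPer u L p) (hl : L' ≤ L) : KPer u L' p :=
  fun i hi => h i (by omega)

theorem KPer.border {u : ℕ → Bool} {L q s : ℕ} (hq : KPer u L q) :
    KPer u (L - q) s ↔ KPer u L (q + s) := by
  constructor
  · intro h i hi
    rw [h i (by omega), hq (i + s) (by omega)]
    congr 1; omega
  · intro h i hi
    rw [h i (by omega), hq (i + s) (by omega)]
    congr 1; omega

theorem KPer.sub {u : ℕ → Bool} {L p q : ℕ} (hp : KPer u L p) (hq : KPer u L q) (hpq : p ≤ q)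
    (hs : p + q ≤ L) : KPer u L (q - p) := by
  intro i hi
  by_cases h : i + q < L
  · rw [hq i h, hp (i + (q - p)) (by omega)]
    congr 1; omega
  · have h1 := hp (i - p) (by omega)
    have h2 := hq (i - p) (by omega)
    rw [show i - p + p = i by omega] at h1
    rw [← h1, h2]
    congr 1; omega

/-- `q` is the least positive period. -/
def KMin (u : ℕ → Bool) (L q : ℕ) : Prop := 0 < q ∧ KPer u L q ∧ ∀ s, 0 < s → KPer u L s → q ≤ s

theorem KMin.exists_le {u : ℕ → Bool} {L g : ℕ} (hg : 0 < g) (h : KPer u L g) :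
    ∃ q, q ≤ g ∧ KMin u L q := by
  classical
  have hex : ∃ q, 0 < q ∧ KPer u L q := ⟨g, hg, h⟩
  exact ⟨Nat.find hex, Nat.find_min' hex ⟨hg, h⟩, (Nat.find_spec hex).1, (Nat.find_spec hex).2,
    fun s hs hs' => Nat.find_min' hex ⟨hs, hs'⟩⟩

theorem KMin.dvd {u : ℕ → Bool} {L q : ℕ} (h : KMin u L q) :
    ∀ s, KPer u L s → s + q ≤ L → q ∣ s := by
  intro s
  induction s using Nat.strong_induction_on with
  | _ s ih =>
    intro hs hl
    rcases Nat.eq_zero_or_pos s with rfl | hpos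
    · exact dvd_zero _
    have hle := h.2.2 s hpos hs
    have h1 := ih (s - q) (by have := h.1; omega) (h.2.1.sub hs hle (by omega)) (by omega)
    have := Nat.dvd_add h1 (dvd_refl q)
    rwa [Nat.sub_add_cancel hle] at this

theorem KPer.mul {u : ℕ → Bool} {L q : ℕ} (h : KPer u L q) (k : ℕ) : KPer u L (q * k) := by
  induction k with
  | zero => exact KPer.zero u L
  | succ k ih =>
    rw [Nat.mul_succ, Nat.add_comm, ← h.border]
    exact ih.restrict (by omega)

theorem KMin.shift {u : ℕ → Bool} {L q : ℕ} (h : KMin u L q) :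
    KA u L = KShift q (KA u (L - q)) := by
  ext s
  simp only [KA, KShift, Set.mem_ofPred_eq]
  constructor
  · intro hs
    rcases Nat.eq_zero_or_pos s with rfl | hpos
    · exact Or.inl rfl
    · have := h.2.2 s hpos hs
      refine Or.inr ⟨this, ?_⟩
      rw [h.2.1.border, Nat.add_sub_cancel' this]
      exact hs
  · rintro (rfl | ⟨h1, h2⟩)
    · exact KPer.zero u L
    · rw [h.2.1.border, Nat.add_sub_cancel' h1] at h2
      exact h2

/-- multiples of `q` below `j`, then `j + A`. -/
def KMulShift (q j : ℕ) (A : Set ℕ) : Set ℕ := {p | (p < j ∧ q ∣ p) ∨ (j ≤ p ∧ p - j ∈ A)}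

theorem KMin.mulShift {u : ℕ → Bool} {L q k : ℕ} (h : KMin u L q) (hk : q * k + q ≤ L) :
    KA u L = KMulShift q (q * k) (KA u (L - q * k)) := by
  ext s
  simp only [KA, KMulShift, Set.mem_ofPred_eq]
  constructor
  · intro hs
    by_cases hlt : s < q * k
    · exact Or.inl ⟨hlt, h.dvd s hs (by omega)⟩
    · refine Or.inr ⟨by omega, ?_⟩
      rw [(h.2.1.mul k).border, Nat.add_sub_cancel' (by omega)]
      exact hs
  · rintro (⟨h1, k', rfl⟩ | ⟨h1, h2⟩)
    · exact h.2.1.mul k'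
    · rw [(h.2.1.mul k).border, Nat.add_sub_cancel' h1] at h2
      exact h2


def KT : ℕ → ℕ
  | 0 => 1
  | (n + 1) => 3 * (n + 1) * KT ((n + 1) / 2)
decreasing_by omega

theorem KT_pos (n : ℕ) : 0 < KT n := by
  induction n using Nat.strong_induction_on with
  | _ n ih =>
    cases n with
    | zero => simp [KT]
    | succ n =>
      rw [KT]
      have := ih ((n + 1) / 2) (by omega)
      positivity

theorem KT_mono {m n : ℕ} (h : m ≤ n) : KT m ≤ KT n := by
  induction n using Nat.strong_induction_on generalizing m with
  | _ n ih =>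
    cases m with
    | zero => rw [KT]; exact KT_pos n
    | succ m =>
      cases n with
      | zero => omega
      | succ n =>
        rw [KT, KT]
        exact Nat.mul_le_mul (by omega) (ih _ (by omega) (by omega))

theorem KT_bound (m : ℕ) : ∀ n, n < 2 ^ m → KT n ≤ 3 ^ m * 2 ^ (∑ i ∈ Finset.range (m + 1), i) := by
  induction m with
  | zero => intro n hn; obtain rfl : n = 0 := by simpa using hn
            simp [KT]
  | succ m ih =>
    intro n hn
    cases n with
    | zero => simp only [KT]; exact Nat.succ_le_of_lt (by positivity)
    | succ n =>
      rw [KT, Finset.sum_range_succ, pow_add, pow_succ]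
      have := ih ((n + 1) / 2) (by rw [pow_succ] at hn; omega)
      calc 3 * (n + 1) * KT ((n + 1) / 2)
          ≤ 3 * 2 ^ (m + 1) * (3 ^ m * 2 ^ (∑ i ∈ Finset.range (m + 1), i)) :=
            Nat.mul_le_mul (by omega) this
        _ = _ := by ring

def KCover (L g N : ℕ) : Prop :=
  ∃ C : Finset (Set ℕ), C.card ≤ N ∧ ∀ u, KPer u L g → KA u L ∈ C

/-- Covers all words with a minimal period `q < g`. -/
theorem KStep {g N : ℕ} (ih : ∀ g', 0 < g' → g' ≤ g / 2 → ∀ L, KCover L g' N) (L : ℕ) :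
    ∃ C : Finset (Set ℕ), C.card ≤ (g - 1) * N ∧
      ∀ u q, KPer u L g → KMin u L q → q < g → KA u L ∈ C := by
  classical
  have hq : ∀ q, ∃ C : Finset (Set ℕ), C.card ≤ N ∧
      (0 < q → q < g → ∀ u, KPer u L g → KMin u L q → KA u L ∈ C) := by
    intro q
    by_cases hq0 : 0 < q ∧ q < g
    swap
    · exact ⟨∅, by simp, fun h1 h2 => absurd ⟨h1, h2⟩ hq0⟩
    by_cases hle : q ≤ g / 2
    · obtain ⟨C, hC, hC'⟩ := ih q hq0.1 hle L
      exact ⟨C, hC, fun _ _ u _ hm => hC' u hm.2.1⟩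
    · obtain ⟨C, hC, hC'⟩ := ih (g - q) (by omega) (by omega) (L - q)
      refine ⟨C.image (KShift q), Finset.card_image_le.trans hC, fun _ _ u hg hm => ?_⟩
      rw [hm.shift]
      refine Finset.mem_image_of_mem _ (hC' u ?_)
      rw [hm.2.1.border, Nat.add_sub_cancel' (by omega)]
      exact hg
  choose C hC hC' using hq
  refine ⟨(Finset.Ico 1 g).biUnion C, ?_, ?_⟩
  · refine (Finset.card_biUnion_le_card_mul _ _ N (fun q _ => hC q)).trans ?_
    simp
  · intro u q hg hm hlt
    exact Finset.mem_biUnion.2 ⟨q, Finset.mem_Ico.2 ⟨hm.1, hlt⟩, hC' q hm.1 hlt u hg hm⟩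

/-- Arbitrary words of length `r ≤ g`. -/
theorem KFree {g N : ℕ} (hg : 0 < g) (ih : ∀ g', 0 < g' → g' ≤ g / 2 → ∀ L, KCover L g' N)
    {r : ℕ} (hr : r ≤ g) :
    ∃ C : Finset (Set ℕ), C.card ≤ (g - 1) * N + 1 ∧ ∀ u, KA u r ∈ C := by
  classical
  rcases Nat.eq_zero_or_pos r with rfl | hr0
  · refine ⟨{Set.univ}, by simp, fun u => ?_⟩
    simp only [Finset.mem_singleton]
    ext p; simp [KA, KPer]
  obtain ⟨C, hC, hC'⟩ := KStep (g := r) (N := N)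
    (fun g' h1 h2 L => ih g' h1 (by omega) L) r
  refine ⟨insert (KShift r Set.univ) C, ?_, fun u => ?_⟩
  · refine (Finset.card_insert_le _ _).trans ?_
    have : (r - 1) * N ≤ (g - 1) * N := Nat.mul_le_mul (by omega) le_rfl
    omega
  · have hp : KPer u r r := KPer.big u le_rfl
    obtain ⟨q, hq, hm⟩ := KMin.exists_le hr0 hp
    rcases hq.lt_or_eq with hlt | rfl
    · exact Finset.mem_insert_of_mem (hC' u q hp hm hlt)
    · rw [hm.shift]
      have : KA u (q - q) = Set.univ := by ext p; simp [KA, KPer]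
      rw [this]
      exact Finset.mem_insert_self _ _

theorem KMain (g : ℕ) : 0 < g → ∀ L, KCover L g (KT g) := by
  classical
  induction g using Nat.strong_induction_on with
  | _ g IH =>
    intro hg L
    set N := KT (g / 2) with hN
    have hNpos : 0 < N := KT_pos _
    have hT : KT g = 3 * g * N := by
      cases g with
      | zero => omega
      | succ g => rw [KT]
    have ih : ∀ g', 0 < g' → g' ≤ g / 2 → ∀ L, KCover L g' N := by
      intro g' h1 h2 L
      obtain ⟨C, hC, hC'⟩ := IH g' (by omega) h1 L
      exact ⟨C, hC.trans (KT_mono h2), hC'⟩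
    obtain ⟨k, L', hLL, hL'1, hk⟩ : ∃ k L', L = g * k + L' ∧ L' - g ≤ g ∧ (k = 0 ∨ g ≤ L') := by
      by_cases h : L < g
      · exact ⟨0, L, by simp, by omega, Or.inl rfl⟩
      · refine ⟨L / g - 1, L % g + g, ?_, ?_, Or.inr (by omega)⟩
        · have h1 := Nat.div_add_mod L g
          have h2 : 1 ≤ L / g := (Nat.one_le_div_iff hg).2 (by omega)
          obtain ⟨d, hd⟩ := Nat.exists_eq_add_of_le h2
          rw [hd] at h1 ⊢
          rw [Nat.mul_add] at h1
          simp only [Nat.add_sub_cancel_left]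
          omega
        · have := Nat.mod_lt L hg
          omega
    obtain ⟨C1, hC1, hC1'⟩ := KStep ih L
    obtain ⟨C2, hC2, hC2'⟩ := KStep ih L'
    obtain ⟨C3, hC3, hC3'⟩ := KFree hg ih hL'1
    refine ⟨C1 ∪ (C2 ∪ C3.image (KShift g)).image (KMulShift g (g * k)), ?_, fun u hu => ?_⟩
    · have e1 := Finset.card_union_le C1 ((C2 ∪ C3.image (KShift g)).image (KMulShift g (g * k)))
      have e2 := Finset.card_image_le (s := C2 ∪ C3.image (KShift g)) (f := KMulShift g (g * k))
      have e3 := Finset.card_union_le C2 (C3.image (KShift g))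
      have e4 := Finset.card_image_le (s := C3) (f := KShift g)
      have e5 : (g - 1) * N + N = g * N := by
        obtain ⟨d, rfl⟩ := Nat.exists_eq_add_of_le hg
        simp only [Nat.add_sub_cancel_left]; ring
      have e6 : 3 * g * N = 3 * (g * N) := by ring
      rw [hT]
      omega
    · obtain ⟨q, hq, hm⟩ := KMin.exists_le hg hu
      rcases hq.lt_or_eq with hlt | rfl
      · exact Finset.mem_union_left _ (hC1' u q hu hm hlt)
      refine Finset.mem_union_right _ ?_
      have hA : KA u L = KMulShift q (q * k) (KA u L') := by
        rcases hk with rfl | hk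
        · simp only [Nat.mul_zero, Nat.zero_add] at hLL ⊢
          subst hLL
          ext p; simp [KMulShift]
        · have := hm.mulShift (k := k) (by omega)
          rwa [show L - q * k = L' by omega] at this
      rw [hA]
      refine Finset.mem_image_of_mem _ ?_
      have hu' : KPer u L' q := hu.restrict (by omega)
      obtain ⟨q', hq', hm'⟩ := KMin.exists_le hg hu'
      rcases hq'.lt_or_eq with hlt | rfl
      · exact Finset.mem_union_left _ (hC2' u q' hu' hm' hlt)
      · refine Finset.mem_union_right _ ?_
        rw [hm'.shift]
        exact Finset.mem_image_of_mem _ (hC3' u)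

/-- Extension of a finite word. -/
def KExt {n : ℕ} (u : Fin n → Bool) : ℕ → Bool := fun i => if h : i < n then u ⟨i, h⟩ else false

theorem KExt_periodSet {n : ℕ} (u : Fin n → Bool) :
    PeriodSet n u = KA (KExt u) n ∩ Set.Iio n := by
  ext p
  simp only [PeriodSet, IsPeriod, KA, KPer, Set.mem_ofPred_eq, Set.mem_inter_iff, Set.mem_Iio]
  constructor
  · rintro ⟨h1, h2⟩
    refine ⟨fun i hi => ?_, h1⟩
    have := h2 i hi
    simpa [KExt, hi, show i < n by omega] using this
  · rintro ⟨h1, h2⟩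
    refine ⟨h2, fun i hi => ?_⟩
    have := h1 i hi
    simpa [KExt, hi, show i < n by omega] using this

theorem kappa_le {n : ℕ} (hn : 0 < n) : kappa n ≤ KT n := by
  classical
  obtain ⟨C, hC, hC'⟩ := KMain n hn n
  refine le_trans ?_ hC
  rw [kappa]
  refine le_trans (Set.ncard_le_ncard (t := ((C.image (fun A => A ∩ Set.Iio n) : Finset (Set ℕ)) : Set (Set ℕ))) ?_
    (Finset.finite_toSet _)) ?_
  · rintro S ⟨u, rfl⟩
    rw [KExt_periodSet]
    exact Finset.mem_coe.2 (Finset.mem_image_of_mem (fun A => A ∩ Set.Iio n)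
      (hC' _ (KPer.big _ le_rfl)))
  · rw [Set.ncard_coe_finset]
    exact Finset.card_image_le


structure KGood (k L : ℕ) (u : ℕ → Bool) : Prop where
  pos : 0 < L
  le : L ≤ (k + 1) * 2 ^ k
  first : u 0 = true
  last : u (L - 1) = true
  run : ∀ i, i + 2 ^ k ≤ L → ∃ j, j < 2 ^ k ∧ u (i + j) = true

/-- The word `v 0^t v`. -/
def KDbl (u : ℕ → Bool) (L t : ℕ) : ℕ → Bool :=
  fun x => if x < L then u x else if x < L + t then false else u (x - (L + t))

theorem KDbl_lt {u : ℕ → Bool} {L t x : ℕ} (h : x < L) : KDbl u L t x = u x := by simp [KDbl, h]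

theorem KDbl_mid {u : ℕ → Bool} {L t x : ℕ} (h : L ≤ x) (h' : x < L + t) :
    KDbl u L t x = false := by simp [KDbl, h', show ¬ x < L by omega]

theorem KDbl_ge {u : ℕ → Bool} {L t x : ℕ} (h : L + t ≤ x) :
    KDbl u L t x = u (x - (L + t)) := by
  simp [KDbl, show ¬ x < L by omega, show ¬ x < L + t by omega]

theorem KGood.dbl {k L t : ℕ} {u : ℕ → Bool} (h : KGood k L u) (ht : t < 2 ^ (k + 1)) :
    KGood (k + 1) (2 * L + t) (KDbl u L t) := by
  have hL := h.pos
  have hp : 2 ^ (k + 1) = 2 * 2 ^ k := by ring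
  refine ⟨by omega, ?_, ?_, ?_, ?_⟩
  · have := h.le
    have e : (k + 1 + 1) * 2 ^ (k + 1) = 2 * ((k + 1) * 2 ^ k) + 2 ^ (k + 1) := by ring
    omega
  · rw [KDbl_lt hL]; exact h.first
  · rw [KDbl_ge (by omega), show 2 * L + t - 1 - (L + t) = L - 1 by omega]; exact h.last
  · intro i hi
    by_cases h1 : i + 2 ^ (k + 1) ≤ L
    · obtain ⟨j, hj, hj'⟩ := h.run i (by omega)
      exact ⟨j, by omega, by rw [KDbl_lt (by omega)]; exact hj'⟩
    by_cases h2 : i < L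
    · refine ⟨L - 1 - i, by omega, ?_⟩
      rw [KDbl_lt (by omega), show i + (L - 1 - i) = L - 1 by omega]; exact h.last
    by_cases h3 : i ≤ L + t
    · refine ⟨L + t - i, by omega, ?_⟩
      rw [KDbl_ge (by omega), show i + (L + t - i) - (L + t) = 0 by omega]; exact h.first
    · obtain ⟨j, hj, hj'⟩ := h.run (i - (L + t)) (by omega)
      refine ⟨j, by omega, ?_⟩
      rw [KDbl_ge (by omega), show i + j - (L + t) = i - (L + t) + j by omega]; exact hj'

theorem KGood.min {k L t : ℕ} {u : ℕ → Bool} (h : KGood k L u) (ht : 2 ^ k ≤ t) :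
    KMin (KDbl u L t) (2 * L + t) (L + t) := by
  have hL := h.pos
  refine ⟨by omega, ?_, ?_⟩
  · intro i hi
    rw [KDbl_lt (by omega), KDbl_ge (by omega), Nat.add_sub_cancel]
  · intro p hp hper
    by_contra hlt
    have hlast : KDbl u L t (2 * L + t - 1) = true := by
      rw [KDbl_ge (by omega), show 2 * L + t - 1 - (L + t) = L - 1 by omega]; exact h.last
    by_cases h1 : L < p
    · have e := hper (2 * L + t - p - 1) (by omega)
      rw [KDbl_mid (by omega) (by omega),
        show 2 * L + t - p - 1 + p = 2 * L + t - 1 by omega, hlast] at e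
      exact absurd e (by decide)
    by_cases h2 : p ≤ t
    · have e := hper (L + t - p) (by omega)
      rw [KDbl_mid (by omega) (by omega), KDbl_ge (by omega),
        show L + t - p + p - (L + t) = 0 by omega, h.first] at e
      exact absurd e (by decide)
    · obtain ⟨j, hj, hj'⟩ := h.run (p - t) (by omega)
      have e := hper (L + j) (by omega)
      rw [KDbl_mid (by omega) (by omega), KDbl_ge (by omega),
        show L + j + p - (L + t) = p - t + j by omega, hj'] at e
      exact absurd e (by decide)

theorem KGood.set {k L t : ℕ} {u : ℕ → Bool} (h : KGood k L u) (ht : 2 ^ k ≤ t) :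
    KA (KDbl u L t) (2 * L + t) = KShift (L + t) (KA u L) := by
  rw [(h.min ht).shift, show 2 * L + t - (L + t) = L by omega]
  congr 1
  ext p
  simp only [KA, KPer, Set.mem_ofPred_eq]
  refine forall_congr' fun i => ?_
  constructor
  · intro hh hi
    have := hh hi
    rwa [KDbl_lt (by omega), KDbl_lt (by omega)] at this
  · intro hh hi
    rw [KDbl_lt (by omega), KDbl_lt (by omega)]
    exact hh hi

theorem KShift_inj {p q : ℕ} {A B : Set ℕ} (hp : 0 < p) (hq : 0 < q) (hA : 0 ∈ A) (hB : 0 ∈ B)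
    (h : KShift p A = KShift q B) : p = q ∧ A = B := by
  have h1 : p ∈ KShift q B := by rw [← h]; exact Or.inr ⟨le_rfl, by simpa using hA⟩
  have h2 : q ∈ KShift p A := by rw [h]; exact Or.inr ⟨le_rfl, by simpa using hB⟩
  have hpq : p = q := by
    simp only [KShift, Set.mem_ofPred_eq] at h1 h2
    omega
  subst hpq
  refine ⟨rfl, ?_⟩
  ext x
  have := Set.ext_iff.1 h (p + x)
  simpa [KShift, show p + x ≠ 0 by omega, show p ≠ 0 by omega] using this

theorem KFam (k : ℕ) : ∃ C : Finset (ℕ × Set ℕ), C.card = 2 ^ (∑ i ∈ Finset.range k, i) ∧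
    ∀ x ∈ C, ∃ u, KGood k x.1 u ∧ x.2 = KA u x.1 := by
  classical
  induction k with
  | zero =>
    refine ⟨{(1, KA (fun _ => true) 1)}, by simp, ?_⟩
    intro x hx
    rw [Finset.mem_singleton] at hx
    subst hx
    exact ⟨fun _ => true, ⟨by simp, by simp, rfl, rfl, fun i _ => ⟨0, by simp, rfl⟩⟩, rfl⟩
  | succ k ih =>
    obtain ⟨C, hC, hC'⟩ := ih
    refine ⟨(C ×ˢ Finset.Ico (2 ^ k) (2 ^ (k + 1))).image
      (fun y => (2 * y.1.1 + y.2, KShift (y.1.1 + y.2) y.1.2)), ?_, ?_⟩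
    · rw [Finset.card_image_of_injOn, Finset.card_product, hC, Finset.sum_range_succ,
        Nat.card_Ico, show 2 ^ (k + 1) - 2 ^ k = 2 ^ k by rw [pow_succ]; omega, ← pow_add]
      · rintro ⟨⟨L, A⟩, t⟩ hy ⟨⟨L', A'⟩, t'⟩ hy' heq
        simp only [Finset.coe_product, Set.mem_prod, Finset.mem_coe, Finset.mem_Ico] at hy hy'
        obtain ⟨u, hu, hA⟩ := hC' _ hy.1
        obtain ⟨u', hu', hA'⟩ := hC' _ hy'.1
        simp only at hu hu' hA hA'
        simp only [Prod.mk.injEq] at heq ⊢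
        have p1 := hu.pos
        have p2 := hu'.pos
        obtain ⟨e1, e2⟩ := KShift_inj (by omega) (by omega) (by rw [hA]; exact KPer.zero _ _)
          (by rw [hA']; exact KPer.zero _ _) heq.2
        exact ⟨⟨by omega, e2⟩, by omega⟩
    · intro x hx
      obtain ⟨⟨⟨L, A⟩, t⟩, hy, rfl⟩ := Finset.mem_image.1 hx
      simp only [Finset.mem_product, Finset.mem_Ico] at hy
      obtain ⟨u, hu, hA⟩ := hC' _ hy.1
      simp only at hu hA
      refine ⟨KDbl u L t, hu.dbl hy.2.2, ?_⟩
      simp only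
      rw [hu.set hy.2.1, hA]

theorem kappa_ge {n k : ℕ} (hn : (2 * k + 3) * 2 ^ k ≤ n) :
    2 ^ (∑ i ∈ Finset.range k, i) ≤ kappa n := by
  classical
  obtain ⟨C, hC, hC'⟩ := KFam k
  have hbd : ∀ x ∈ C, 0 < x.1 ∧ 2 * x.1 + 2 ^ k ≤ n ∧ 2 * x.1 ≤ n := by
    intro x hx
    obtain ⟨u, hu, -⟩ := hC' x hx
    have := hu.le
    have h0 : 0 < 2 ^ k := by positivity
    have e : (2 * k + 3) * 2 ^ k = 2 * ((k + 1) * 2 ^ k) + 2 ^ k := by ring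
    exact ⟨hu.pos, by omega, by omega⟩
  have hz : ∀ x ∈ C, 0 ∈ x.2 ∧ ∀ p, x.1 ≤ p → p ∈ x.2 := by
    intro x hx
    obtain ⟨u, hu, hA⟩ := hC' x hx
    rw [hA]
    exact ⟨KPer.zero _ _, fun p hp => KPer.big _ hp⟩
  rw [← hC, kappa]
  rw [← Set.ncard_coe_finset C]
  refine Set.ncard_le_ncard_of_injOn (fun x => KShift (n - x.1) x.2 ∩ Set.Iio n) ?_ ?_ ?_
  · intro x hx
    have hx : x ∈ C := hx
    obtain ⟨u, hu, hA⟩ := hC' x hx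
    have hb := hbd x hx
    have hs := hu.set (t := n - 2 * x.1) (by omega)
    rw [show 2 * x.1 + (n - 2 * x.1) = n by omega, show x.1 + (n - 2 * x.1) = n - x.1 by omega]
      at hs
    refine ⟨fun i => KDbl u x.1 (n - 2 * x.1) i, ?_⟩
    rw [KExt_periodSet, hA, ← hs]
    ext p
    simp only [Set.mem_inter_iff, Set.mem_Iio, and_congr_left_iff, KA, KPer, Set.mem_ofPred_eq]
    intro hp
    refine forall_congr' fun i => ?_
    refine forall_congr' fun hi => ?_
    simp [KExt, hi, show i < n by omega]
  · intro x hx y hy heq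
    have hx : x ∈ C := hx
    have hy : y ∈ C := hy
    have bx := hbd x hx
    have bY := hbd y hy
    have full : KShift (n - x.1) x.2 = KShift (n - y.1) y.2 := by
      ext p
      by_cases hp : p < n
      · have := Set.ext_iff.1 heq p
        simpa [hp] using this
      · simp only [KShift, Set.mem_ofPred_eq]
        constructor
        · intro _
          exact Or.inr ⟨by omega, (hz y hy).2 _ (by omega)⟩
        · intro _
          exact Or.inr ⟨by omega, (hz x hx).2 _ (by omega)⟩
    obtain ⟨e1, e2⟩ := KShift_inj (by omega) (by omega) (hz x hx).1 (hz y hy).1 full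
    exact Prod.ext (by omega) e2
  · have : {S : Set ℕ | ∃ u : Fin n → Bool, S = PeriodSet n u}
        = Set.range (fun u : Fin n → Bool => PeriodSet n u) := by
      ext S; simp [eq_comm]
    rw [this]
    exact Set.finite_range _


open Filter Topology

theorem KlogTop : Tendsto (fun n : ℕ => Nat.log 2 n) atTop atTop := by
  refine tendsto_atTop_atTop.2 fun b => ⟨2 ^ b, fun n hn => ?_⟩
  exact Nat.le_log_of_pow_le (by norm_num) hn

theorem KrlogTop : Tendsto (fun n : ℕ => Real.log n) atTop atTop :=
  Real.tendsto_log_atTop.comp tendsto_natCast_atTop_atTop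

theorem KlogRatio : Tendsto (fun n : ℕ => (Nat.log 2 n : ℝ) / Real.log n) atTop
    (𝓝 (1 / Real.log 2)) := by
  have h2 : 0 < Real.log 2 := Real.log_pos (by norm_num)
  have hb : Tendsto (fun n : ℕ => Real.logb 2 n) atTop atTop :=
    (Real.tendsto_logb_atTop (by norm_num)).comp tendsto_natCast_atTop_atTop
  have h := (tendsto_nat_floor_div_atTop (R := ℝ)).comp hb
  have h' := h.mul_const (1 / Real.log 2)
  rw [one_mul] at h'
  refine h'.congr' ?_
  filter_upwards [KrlogTop.eventually_gt_atTop 0] with n hn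
  have e : ⌊Real.logb 2 (n : ℝ)⌋₊ = Nat.log 2 n := by
    have := Real.natFloor_logb_natCast 2 n
    simpa using this
  simp only [Function.comp, e]
  rw [Real.logb]
  field_simp

theorem KlogLog : Tendsto (fun n : ℕ => (Nat.log 2 (Nat.log 2 n) : ℝ) / Real.log n) atTop
    (𝓝 0) := by
  have h1 := KlogRatio.comp KlogTop
  have h3 : Tendsto (fun n : ℕ => Real.log (Nat.log 2 n : ℝ) / (Nat.log 2 n : ℝ)) atTop (𝓝 0) := by
    have : Tendsto (fun x : ℝ => Real.log x / x) atTop (𝓝 0) :=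
      Real.isLittleO_log_id_atTop.tendsto_div_nhds_zero
    exact this.comp (tendsto_natCast_atTop_atTop.comp KlogTop)
  have h := (h1.mul h3).mul KlogRatio
  simp only [mul_zero, zero_mul] at h
  refine h.congr' ?_
  filter_upwards [KlogTop.eventually_gt_atTop 1] with n hn
  have hN : (1 : ℝ) < (Nat.log 2 n : ℝ) := by exact_mod_cast hn
  have hl : Real.log (Nat.log 2 n : ℝ) ≠ 0 := (Real.log_pos hN).ne'
  have hN0 : (Nat.log 2 n : ℝ) ≠ 0 := by linarith
  simp only [Function.comp]
  field_simp

theorem Kgauss (k : ℕ) : ((∑ i ∈ Finset.range k, i : ℕ) : ℝ) = k * (k - 1) / 2 := by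
  induction k with
  | zero => simp
  | succ k ih => rw [Finset.sum_range_succ, Nat.cast_add, ih]; push_cast; ring

theorem Klower_aux : ∀ x, 3 ≤ x → x + 3 ≤ 2 ^ x := by
  intro x hx
  induction x, hx using Nat.le_induction with
  | base => norm_num
  | succ x hx ih => rw [pow_succ]; omega

def Kk (n : ℕ) : ℕ := Nat.log 2 n - (Nat.log 2 (Nat.log 2 n) + 3)

theorem Kk_ev : ∀ᶠ n : ℕ in atTop,
    Kk n + (Nat.log 2 (Nat.log 2 n) + 3) = Nat.log 2 n ∧ (2 * Kk n + 3) * 2 ^ Kk n ≤ n := by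
  filter_upwards [(KlogTop.comp KlogTop).eventually_ge_atTop 3, KlogTop.eventually_gt_atTop 0,
    eventually_gt_atTop 0] with n h1 h2 h3
  simp only [Function.comp] at h1
  have a1 := Klower_aux _ h1
  have a2 := Nat.pow_log_le_self 2 (show Nat.log 2 n ≠ 0 by omega)
  have e : Kk n + (Nat.log 2 (Nat.log 2 n) + 3) = Nat.log 2 n := by
    rw [Kk]; omega
  refine ⟨e, ?_⟩
  have a3 := Nat.lt_pow_succ_log_self (b := 2) (by norm_num) (Nat.log 2 n)
  have a4 := Nat.pow_log_le_self 2 (show n ≠ 0 by omega)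
  set M := Nat.log 2 (Nat.log 2 n) with hM
  calc (2 * Kk n + 3) * 2 ^ Kk n ≤ 2 ^ (M + 3) * 2 ^ Kk n := by
        refine Nat.mul_le_mul ?_ le_rfl
        rw [pow_succ] at a3
        have : 2 ^ (M + 3) = 8 * 2 ^ M := by ring
        omega
    _ = 2 ^ Nat.log 2 n := by rw [← pow_add, ← e]; congr 1; omega
    _ ≤ n := a4

theorem kappa_asymptotics :
    Filter.Tendsto (fun n : ℕ => Real.log (kappa n) / (Real.log n) ^ 2)
      Filter.atTop (nhds (1 / (2 * Real.log 2))) := by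
  have h2 : 0 < Real.log 2 := Real.log_pos (by norm_num)
  have hb : Tendsto (fun n : ℕ => (Real.log n)⁻¹) atTop (𝓝 0) := KrlogTop.inv_tendsto_atTop
  have ha := KlogRatio
  have hc := KlogLog
  have hk : Tendsto (fun n : ℕ => (Kk n : ℝ) / Real.log n) atTop (𝓝 (1 / Real.log 2)) := by
    have := (ha.sub hc).sub (hb.const_mul 3)
    simp only [mul_zero, sub_zero] at this
    refine this.congr' ?_
    filter_upwards [Kk_ev] with n hn
    have e : (Kk n : ℝ) + ((Nat.log 2 (Nat.log 2 n) : ℝ) + 3) = (Nat.log 2 n : ℝ) := by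
      exact_mod_cast hn.1
    rw [← e]
    ring
  have hlow : Tendsto (fun n : ℕ => ((Kk n : ℝ) * (Kk n - 1) / 2 * Real.log 2) / (Real.log n) ^ 2)
      atTop (𝓝 (1 / (2 * Real.log 2))) := by
    have := ((hk.mul (hk.sub hb)).div_const 2).mul_const (Real.log 2)
    have e : 1 / Real.log 2 * (1 / Real.log 2 - 0) / 2 * Real.log 2 = 1 / (2 * Real.log 2) := by
      field_simp; simp
    rw [e] at this
    refine this.congr fun n => ?_
    ring
  have hup : Tendsto (fun n : ℕ => (((Nat.log 2 n : ℝ) + 1) * Real.log 3 +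
      ((Nat.log 2 n : ℝ) + 2) * ((Nat.log 2 n : ℝ) + 1) / 2 * Real.log 2) / (Real.log n) ^ 2)
      atTop (𝓝 (1 / (2 * Real.log 2))) := by
    have := (((ha.add hb).mul hb).mul_const (Real.log 3)).add
      ((((ha.add (hb.const_mul 2)).mul (ha.add hb)).div_const 2).mul_const (Real.log 2))
    have e : (1 / Real.log 2 + 0) * 0 * Real.log 3 +
        (1 / Real.log 2 + 2 * 0) * (1 / Real.log 2 + 0) / 2 * Real.log 2
        = 1 / (2 * Real.log 2) := by
      field_simp; simp
    rw [e] at this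
    refine this.congr fun n => ?_
    ring
  refine tendsto_of_tendsto_of_tendsto_of_le_of_le' hlow hup ?_ ?_
  · filter_upwards [Kk_ev] with n hn
    refine div_le_div_of_nonneg_right ?_ (sq_nonneg _)
    have h := kappa_ge hn.2
    have h' : ((2 : ℝ) ^ (∑ i ∈ Finset.range (Kk n), i)) ≤ (kappa n : ℝ) := by exact_mod_cast h
    have h'' := Real.log_le_log (by positivity) h'
    rw [Real.log_pow, Kgauss] at h''
    exact h''
  · filter_upwards [Kk_ev, eventually_gt_atTop 0] with n hn h0
    refine div_le_div_of_nonneg_right ?_ (sq_nonneg _)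
    have hpos : 0 < kappa n := lt_of_lt_of_le (by positivity) (kappa_ge hn.2)
    have h := (kappa_le h0).trans (KT_bound (Nat.log 2 n + 1) n
      (Nat.lt_pow_succ_log_self (by norm_num) n))
    have h' : (kappa n : ℝ) ≤ 3 ^ (Nat.log 2 n + 1) *
        2 ^ (∑ i ∈ Finset.range (Nat.log 2 n + 1 + 1), i) := by exact_mod_cast h
    have h'' := Real.log_le_log (by exact_mod_cast hpos) h'
    rw [Real.log_mul (by positivity) (by positivity), Real.log_pow, Real.log_pow, Kgauss] at h''
    refine h''.trans (le_of_eq ?_)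
    push_cast
    ring
end

section
/- The sequence ln(δ_n)/ln²(n) converges to 1/(2 ln 2) as n → ∞, where δ_n is the number of distinct correlations of pairs of strings of length n. -/
/-- `t` is the correlation of `u` over `v` (equal length `n`): `t k = 1` iff the
suffix of `u` starting at `k` matches the prefix of `v` of the same length. -/
def IsCorr {α : Type*} (n : ℕ) (u v : Fin n → α) (t : Fin n → Bool) : Prop :=
  ∀ k : Fin n, t k = true ↔
    ∀ (j : ℕ) (h : (k : ℕ) + j < n), u ⟨(k : ℕ) + j, h⟩ = v ⟨j, by omega⟩

/-- The set of autocorrelations of (binary) strings of length `j`. -/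
def Gamma (j : ℕ) : Set (Fin j → Bool) :=
  {s | ∃ u : Fin j → Bool, ∀ p : Fin j, s p = true ↔ IsPeriod j u (p : ℕ)}

/-- The set of correlations of pairs of (binary) strings of length `n`. -/
def Delta (n : ℕ) : Set (Fin n → Bool) :=
  {t | ∃ u v : Fin n → Bool, IsCorr n u v t}

/-- `V` has period `p` on `[0,z)`. -/
def PerOn (V : ℕ → Bool) (z p : ℕ) : Prop := ∀ i, i + p < z → V i = V (i + p)

theorem perOn_gcd (V : ℕ → Bool) (z : ℕ) : ∀ s p q : ℕ, p + q ≤ s → 0 < p → 0 < q → p + q ≤ z →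
    PerOn V z p → PerOn V z q → PerOn V z (Nat.gcd p q) := by
  have key : ∀ p q : ℕ, q < p → 0 < q → p + q ≤ z → PerOn V z p → PerOn V z q →
      PerOn V z (p - q) := by
    intro p q hqp hq hz hp hq' i hi
    by_cases h : q ≤ i
    · have h1 := hq' (i - q) (by omega)
      have h2 := hp (i - q) (by omega)
      rw [show i - q + q = i by omega] at h1
      rw [show i - q + p = i + (p - q) by omega] at h2
      rw [← h1, h2]
    · have h1 := hp i (by omega)
      have h2 := hq' (i + (p - q)) (by omega)
      rw [show i + (p - q) + q = i + p by omega] at h2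
      rw [h1, h2]
  intro s
  induction s with
  | zero => intro p q h hp; omega
  | succ s ih =>
    intro p q h hp hq hz hP hQ
    rcases lt_trichotomy p q with hlt | heq | hgt
    · have := ih p (q - p) (by omega) hp (by omega) (by omega) hP
        (key q p hlt hp (by omega) hQ hP)
      rwa [Nat.gcd_sub_self_right hlt.le] at this
    · subst heq; simpa using hP
    · have := ih (p - q) q (by omega) (by omega) hq (by omega)
        (key p q hgt hq (by omega) hP hQ) hQ
      rwa [Nat.gcd_sub_self_left hgt.le] at this

theorem perOn_mul (V : ℕ → Bool) (z p : ℕ) (h : PerOn V z p) (k : ℕ) : PerOn V z (k * p) := by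
  induction k with
  | zero => intro i _; simp
  | succ k ih =>
    intro i hi
    have e : (k + 1) * p = k * p + p := by ring
    rw [e] at hi ⊢
    rw [ih i (by omega), h (i + k * p) (by omega), add_assoc]

/-- Closure conditions satisfied by sets of overlaps. -/
def CC (B : Finset ℕ) : Prop := 0 ∈ B ∧
  (∀ x ∈ B, ∀ y ∈ B, y < x → x ≤ 2 * y → 2 * y - x ∈ B) ∧
  (∀ x ∈ B, ∀ y ∈ B, ∀ c ∈ B, y < x → c < y → (∀ z ∈ B, z < x → z ≤ y) →
    (∀ z ∈ B, z < y → z ≤ c) → c + x = 2 * y ∨ c + y < x)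

def ovl (n : ℕ) (U V : ℕ → Bool) : Finset ℕ :=
  (Finset.range (n + 1)).filter (fun b => ∀ j < b, U (n - b + j) = V j)

theorem mem_ovl {n : ℕ} {U V : ℕ → Bool} {b : ℕ} :
    b ∈ ovl n U V ↔ b ≤ n ∧ ∀ j < b, U (n - b + j) = V j := by
  simp [ovl]

theorem mem_ovl_iff {n : ℕ} {U V : ℕ → Bool} {x y : ℕ} (hx : x ∈ ovl n U V) (hyx : y ≤ x) :
    y ∈ ovl n U V ↔ PerOn V x (x - y) := by
  rw [mem_ovl] at hx ⊢
  obtain ⟨hxn, hx⟩ := hx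
  constructor
  · rintro ⟨_, h⟩ i hi
    rw [← h i (by omega), ← hx (i + (x - y)) hi]
    congr 1; omega
  · intro h
    refine ⟨by omega, fun j hj => ?_⟩
    rw [h j (by omega), ← hx (j + (x - y)) (by omega)]
    congr 1; omega

theorem CC_ovl (n : ℕ) (U V : ℕ → Bool) : CC (ovl n U V) := by
  refine ⟨by simp [mem_ovl], ?_, ?_⟩
  · intro x hx y hy hyx hxy
    have h := (mem_ovl_iff hx hyx.le).1 hy
    rw [mem_ovl_iff hx (by omega)]
    have := perOn_mul V x _ h 2
    rwa [show 2 * (x - y) = x - (2 * y - x) by omega] at this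
  · intro x hx y hy c hc hyx hcy hxy hyc
    by_contra hcon
    push Not at hcon
    obtain ⟨h1, h2⟩ := hcon
    have hp := (mem_ovl_iff hx hyx.le).1 hy
    have hq := (mem_ovl_iff hy hcy.le).1 hc
    have hp' : PerOn V y (x - y) := fun i hi => hp i (by omega)
    have hg := perOn_gcd V y _ (x - y) (y - c) le_rfl (by omega) (by omega) (by omega) hp' hq
    set g := Nat.gcd (x - y) (y - c) with hgdef
    have hgpos : 0 < g := Nat.gcd_pos_of_pos_left _ (by omega)
    have hgle : g ≤ y - c := Nat.gcd_le_right _ (by omega)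
    have hgm : y - g ∈ ovl n U V := by
      rw [mem_ovl_iff hy (by omega)]
      rwa [show y - (y - g) = g by omega]
    have hgc := hyc _ hgm (by omega)
    have hgq : g = y - c := by omega
    have hdvd : g ∣ x - y := Nat.gcd_dvd_left _ _
    have hgx : PerOn V x g := by
      intro i hi
      have hm := Nat.mod_add_div i (x - y)
      have hlt := Nat.mod_lt i (show x - y > 0 by omega)
      set r := i % (x - y)
      have hk := perOn_mul V x _ hp (i / (x - y))
      have e : i = r + i / (x - y) * (x - y) := by rw [mul_comm]; exact hm.symm
      have h3 := hk r (by omega)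
      have h4 := hk (r + g) (by omega)
      have h5 := hg r (by omega)
      rw [← e] at h3
      rw [show r + g + i / (x - y) * (x - y) = i + g by omega] at h4
      rw [← h3, ← h4, h5]
    have hgl : g ≤ x - y := Nat.le_of_dvd (by omega) hdvd
    have hmem : x - g ∈ ovl n U V := by
      rw [mem_ovl_iff hx (by omega)]
      rwa [show x - (x - g) = g by omega]
    have := hxy _ hmem (by omega)
    omega

def WW (t : ℕ) : ℕ := if h : t = 0 then 1 else 1 + 2 * t * WW (t / 2)
termination_by t
decreasing_by omega

theorem count (t : ℕ) : ∀ (a : ℕ) (F : Finset (Finset ℕ)), (∀ B ∈ F, CC B) → (∀ B ∈ F, a ∈ B) →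
    (∀ B ∈ F, ∀ B' ∈ F, ∀ x, a ≤ x → x ∈ B → x ∈ B') →
    (∀ x, x ≤ a → 0 < x → (∀ B ∈ F, x ∈ B) → ∃ y, y < x ∧ x ≤ y + t ∧ ∀ B ∈ F, y ∈ B) →
    F.card ≤ WW t := by
  induction t using Nat.strong_induction_on with
  | _ t ih =>
  intro a F hCC ha hagree hgap
  have hW1 : 1 ≤ WW t := by rw [WW]; split_ifs <;> omega
  rcases F.eq_empty_or_nonempty with rfl | ⟨B0, hB0⟩
  · simp
  rcases Nat.eq_zero_or_pos a with rfl | hapos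
  · refine le_trans (Finset.card_le_one.2 ?_) hW1
    intro B hB B' hB'
    ext x
    exact ⟨hagree B hB B' hB' x (Nat.zero_le _), hagree B' hB' B hB x (Nat.zero_le _)⟩
  obtain ⟨l, hla, hlt, hlI⟩ := hgap a le_rfl hapos ha
  have ht : t ≠ 0 := by omega
  classical
  set I : Finset ℕ := B0.filter (fun x => ∀ B ∈ F, x ∈ B) with hI
  have memI : ∀ x, x ∈ I ↔ ∀ B ∈ F, x ∈ B := by
    intro x; simp only [hI, Finset.mem_filter]
    exact ⟨fun h => h.2, fun h => ⟨h _ hB0, h⟩⟩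
  have hIFP : ∀ x ∈ I, ∀ y ∈ I, y < x → x ≤ 2 * y → 2 * y - x ∈ I := by
    intro x hx y hy h1 h2
    rw [memI] at *
    exact fun B hB => (hCC B hB).2.1 x (hx B hB) y (hy B hB) h1 h2
  have hI0 : 0 ∈ I := (memI 0).2 fun B hB => (hCC B hB).1
  have haI : a ∈ I := (memI a).2 ha
  have hlI' : l ∈ I := (memI l).2 hlI
  let Fc : ℕ → Finset (Finset ℕ) := fun c =>
    F.filter (fun B => c ∈ B ∧ c ∉ I ∧ ∀ x ∈ B, c < x → x ∈ I)
  let C : Finset ℕ := Finset.Ioo l a ∪ Finset.range t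
  have hsucc : ∀ c, c < a → ∃ z ∈ I, c < z ∧ z ≤ a ∧ ∀ w ∈ I, c < w → z ≤ w := by
    intro c hc
    have hne : (I.filter (fun x => c < x)).Nonempty := ⟨a, by simp [haI, hc]⟩
    refine ⟨(I.filter (fun x => c < x)).min' hne, ?_⟩
    have := Finset.min'_mem _ hne
    rw [Finset.mem_filter] at this
    refine ⟨this.1, this.2, Finset.min'_le _ _ (by simp [haI, hc]), ?_⟩
    intro w hw hcw
    exact Finset.min'_le _ _ (by simp [hw, hcw])
  have hsub : F ⊆ insert I (C.biUnion Fc) := by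
    intro B hB
    rw [Finset.mem_insert]
    by_cases hBI : B = I
    · exact Or.inl hBI
    right
    have hIB : I ⊆ B := fun x hx => (memI x).1 hx B hB
    have hne : (B \ I).Nonempty := by
      rw [Finset.sdiff_nonempty]
      exact fun h => hBI (Finset.Subset.antisymm h hIB)
    set c := (B \ I).max' hne with hc
    have hcm := Finset.max'_mem _ hne
    rw [← hc, Finset.mem_sdiff] at hcm
    have hmax : ∀ x ∈ B, c < x → x ∈ I := by
      intro x hx hcx
      by_contra hxI
      have := Finset.le_max' (B \ I) x (by simp [hx, hxI])
      omega
    rw [Finset.mem_biUnion]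
    refine ⟨c, ?_, by simp only [Fc, Finset.mem_filter]; exact ⟨hB, hcm.1, hcm.2, hmax⟩⟩
    have hca : c < a := by
      by_contra hge
      exact hcm.2 ((memI c).2 fun B' hB' => hagree B hB B' hB' c (by omega) hcm.1)
    simp only [C, Finset.mem_union, Finset.mem_Ioo, Finset.mem_range]
    by_cases hlc : l < c
    · exact Or.inl ⟨hlc, hca⟩
    right
    have hcl : c < l := by
      rcases Nat.lt_or_ge c l with h | h
      · exact h
      · exact absurd (show c ∈ I by rwa [show c = l by omega]) hcm.2
    obtain ⟨z, hzI, hcz, hza, hzmin⟩ := hsucc c hca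
    have hzl : z ≤ l := hzmin l hlI' hcl
    obtain ⟨z', hzI', hzz, hza', hzmin'⟩ := hsucc z (by omega)
    obtain ⟨y, hy1, hy2, hy3⟩ := hgap z' hza' (by omega) ((memI _).1 hzI')
    have hyz : y ≤ z := by
      by_contra h
      have := hzmin' y ((memI _).2 hy3) (by omega)
      omega
    have := (hCC B hB).2.2 z' (hIB hzI') z (hIB hzI) c hcm.1 hzz hcz ?_ ?_
    · rcases this with h | h
      · exfalso
        apply hcm.2
        have := hIFP z' hzI' z hzI hzz (by omega)
        rwa [show 2 * z - z' = c by omega] at this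
      · skip
        omega
    · intro w hw hwz
      by_contra h
      have := hzmin' w (hmax w hw (by omega)) (by omega)
      omega
    · intro w hw hwz
      by_contra h
      have := hzmin w (hmax w hw (by omega)) (by omega)
      omega
  have hFc : ∀ c ∈ C, (Fc c).card ≤ WW (t / 2) := by
    intro c _
    rcases (Fc c).eq_empty_or_nonempty with he | ⟨B1, hB1⟩
    · rw [he]; simp
    have hmem : ∀ B, B ∈ Fc c ↔ B ∈ F ∧ c ∈ B ∧ c ∉ I ∧ ∀ x ∈ B, c < x → x ∈ I := by
      intro B; simp only [Fc, Finset.mem_filter]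
    have hB1' := (hmem B1).1 hB1
    have hcI := hB1'.2.2.1
    have hca : c < a := by
      by_contra hge
      exact hcI ((memI c).2 fun B' hB' => hagree B1 hB1'.1 B' hB' c (by omega) hB1'.2.1)
    have hJ0 : ∀ B ∈ Fc c, 0 ∈ B := fun B hB => (hCC B ((hmem B).1 hB).1).1
    have hcpos : 0 < c := by
      rcases Nat.eq_zero_or_pos c with h | h
      · exact absurd (h ▸ hI0) hcI
      · exact h
    have hIJ : ∀ x ∈ I, ∀ B ∈ Fc c, x ∈ B := fun x hx B hB => (memI x).1 hx B ((hmem B).1 hB).1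
    have hFP : ∀ x y, (∀ B ∈ Fc c, x ∈ B) → (∀ B ∈ Fc c, y ∈ B) → y < x → x ≤ 2 * y →
        ∀ B ∈ Fc c, 2 * y - x ∈ B := fun x y hx hy h1 h2 B hB =>
      (hCC B ((hmem B).1 hB).1).2.1 x (hx B hB) y (hy B hB) h1 h2
    have hcJ : ∀ B ∈ Fc c, c ∈ B := fun B hB => ((hmem B).1 hB).2.1
    have hstep : ∀ x' x, (∀ B ∈ Fc c, x' ∈ B) → (∀ B ∈ Fc c, x ∈ B) → x < x' → 0 < x →
        ∃ y, y < x ∧ x + x ≤ y + x' ∧ ∀ B ∈ Fc c, y ∈ B := by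
      intro x' x hx' hx h1 h2
      by_cases h : x' ≤ 2 * x
      · exact ⟨2 * x - x', by omega, by omega, hFP x' x hx' hx h1 h⟩
      · exact ⟨0, h2, by omega, hJ0⟩
    refine ih (t / 2) (by omega) c (Fc c) (fun B hB => hCC B ((hmem B).1 hB).1) hcJ ?_ ?_
    · intro B hB B' hB' x hcx hxB
      rcases Nat.eq_or_lt_of_le hcx with h | h
      · rw [← h]; exact hcJ B' hB'
      · exact hIJ x (((hmem B).1 hB).2.2.2 x hxB h) B' hB'
    · have hc0 : ∃ y, y < c ∧ c ≤ y + t / 2 ∧ ∀ B ∈ Fc c, y ∈ B := by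
        obtain ⟨z, hzI, hcz, hza, hzmin⟩ := hsucc c hca
        obtain ⟨y, hy1, hy2, hy3⟩ := hgap z hza (by omega) ((memI _).1 hzI)
        have hyI := (memI _).2 hy3
        have hyc : y < c := by
          rcases lt_trichotomy y c with h | h | h
          · exact h
          · exact absurd (h ▸ hyI) hcI
          · have := hzmin y hyI h; omega
        by_cases hh : c ≤ y + t / 2
        · exact ⟨y, hyc, hh, hIJ y hyI⟩
        · obtain ⟨w, hw1, hw2, hw3⟩ := hstep z c (hIJ z hzI) hcJ hcz hcpos
          exact ⟨w, hw1, by omega, hw3⟩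
      have hdown : ∀ k x, c ≤ x + k → x ≤ c → 0 < x → (∀ B ∈ Fc c, x ∈ B) →
          ∃ y, y < x ∧ x ≤ y + t / 2 ∧ ∀ B ∈ Fc c, y ∈ B := by
        intro k
        induction k with
        | zero =>
          intro x h1 h2 _ _
          obtain rfl : x = c := by omega
          exact hc0
        | succ k ihk =>
          intro x h1 h2 h3 h4
          rcases Nat.eq_or_lt_of_le h2 with rfl | hlt
          · exact hc0
          have hex : ∃ z, x < z ∧ z ≤ c ∧ ∀ B ∈ Fc c, z ∈ B := ⟨c, hlt, le_rfl, hcJ⟩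
          obtain ⟨hz1, hz2, hz3⟩ := Nat.find_spec hex
          have hzmin := fun m => @Nat.find_min _ _ hex m
          set z := Nat.find hex
          obtain ⟨y, hy1, hy2, hy3⟩ := ihk z (by omega) hz2 (by omega) hz3
          have hyx : y ≤ x := by
            by_contra h
            exact hzmin y hy1 ⟨by omega, by omega, hy3⟩
          obtain ⟨w, hw1, hw2, hw3⟩ := hstep z x hz3 h4 hz1 h3
          exact ⟨w, hw1, by omega, hw3⟩
      intro x h1 h2 h3
      exact hdown c x (by omega) h1 h2 h3
  have hcard := Finset.card_le_card hsub
  have h1 := Finset.card_insert_le I (C.biUnion Fc)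
  have h2 := Finset.card_biUnion_le_card_mul C Fc _ hFc
  have h3 : C.card ≤ 2 * t := by
    refine le_trans (Finset.card_union_le _ _) ?_
    simp only [Nat.card_Ioo, Finset.card_range]
    omega
  have h4 : C.card * WW (t / 2) ≤ 2 * t * WW (t / 2) := Nat.mul_le_mul_right _ h3
  rw [WW]
  simp only [ht, dite_false]
  omega

theorem CC_zero {B : Finset ℕ} (h : CC B) : 0 ∈ B := h.1

/-- Extension of a finite word by `false`. -/
def extw (n : ℕ) (u : Fin n → Bool) : ℕ → Bool := fun i => if h : i < n then u ⟨i, h⟩ else false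

theorem isCorr_iff (n : ℕ) (u v t : Fin n → Bool) : IsCorr n u v t ↔
    ∀ k : Fin n, t k = true ↔ (n - (k : ℕ)) ∈ ovl n (extw n u) (extw n v) := by
  unfold IsCorr
  refine forall_congr' fun k => ?_
  have hk := k.2
  have : (∀ (j : ℕ) (h : (k : ℕ) + j < n), u ⟨(k : ℕ) + j, h⟩ = v ⟨j, by omega⟩) ↔
      (n - (k : ℕ)) ∈ ovl n (extw n u) (extw n v) := by
    rw [mem_ovl]
    constructor
    · intro h
      refine ⟨by omega, fun j hj => ?_⟩
      have e : n - (n - (k : ℕ)) + j = k + j := by omega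
      have h1 : (k : ℕ) + j < n := by omega
      have h2 : j < n := by omega
      rw [e]
      simp only [extw, h1, h2, dite_true]
      exact h j h1
    · rintro ⟨_, h⟩ j hj
      have h3 := h j (by omega)
      have e : n - (n - (k : ℕ)) + j = k + j := by omega
      have h2 : j < n := by omega
      rw [e] at h3
      simpa only [extw, hj, h2, dite_true] using h3
  rw [this]

theorem delta_upper (n : ℕ) : (Delta n).ncard ≤ (n + 1) * WW n := by
  classical
  let Fj : ℕ → Finset (Finset ℕ) := fun j =>
    (Finset.range (n + 1)).powerset.filter (fun B => CC B ∧ j ∈ B ∧ ∀ x ∈ B, x ≤ j)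
  have hmem : ∀ j B, B ∈ Fj j ↔ B ⊆ Finset.range (n + 1) ∧ CC B ∧ j ∈ B ∧ ∀ x ∈ B, x ≤ j := by
    intro j B; simp only [Fj, Finset.mem_filter, Finset.mem_powerset]
  have hFj : ∀ j ∈ Finset.range (n + 1), (Fj j).card ≤ WW n := by
    intro j hj
    rw [Finset.mem_range] at hj
    refine count n j (Fj j) (fun B hB => ((hmem j B).1 hB).2.1)
      (fun B hB => ((hmem j B).1 hB).2.2.1) ?_ ?_
    · intro B hB B' hB' x hx hxB
      have := ((hmem j B).1 hB).2.2.2 x hxB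
      obtain rfl : x = j := by omega
      exact ((hmem x B').1 hB').2.2.1
    · intro x hx hpos _
      exact ⟨0, hpos, by omega, fun B hB => CC_zero ((hmem j B).1 hB).2.1⟩
  have hU := Finset.card_biUnion_le_card_mul (Finset.range (n + 1)) Fj _ hFj
  rw [Finset.card_range] at hU
  refine le_trans ?_ hU
  let T : (Fin n → Bool) → Finset ℕ := fun t =>
    (Finset.range (n + 1)).filter (fun b => b = 0 ∨ ∃ k : Fin n, t k = true ∧ (k : ℕ) + b = n)
  rw [← Set.ncard_coe_finset]
  refine Set.ncard_le_ncard_of_injOn T ?_ ?_ (Finset.finite_toSet _)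
  · rintro t ⟨u, v, h⟩
    rw [isCorr_iff] at h
    have hT : T t = ovl n (extw n u) (extw n v) := by
      ext b
      simp only [T, Finset.mem_filter, Finset.mem_range]
      constructor
      · rintro ⟨hb, rfl | ⟨k, hk, hkb⟩⟩
        · exact (CC_ovl _ _ _).1
        · have := (h k).1 hk
          rwa [show n - (k : ℕ) = b by omega] at this
      · intro hb
        have hbn := (mem_ovl.1 hb).1
        refine ⟨by omega, ?_⟩
        rcases Nat.eq_zero_or_pos b with h0 | h0
        · exact Or.inl h0
        · right
          refine ⟨⟨n - b, by omega⟩, (h _).2 ?_, by simp; omega⟩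
          simpa [show n - (n - b) = b by omega] using hb
    have hne : (T t).Nonempty := ⟨0, by rw [hT]; exact (CC_ovl _ _ _).1⟩
    have hsubs : T t ⊆ Finset.range (n + 1) := Finset.filter_subset _ _
    rw [Finset.mem_coe, Finset.mem_biUnion]
    refine ⟨(T t).max' hne, hsubs (Finset.max'_mem _ _), (hmem _ _).2 ⟨hsubs, ?_,
      Finset.max'_mem _ _, fun x hx => Finset.le_max' _ _ hx⟩⟩
    rw [hT]; exact CC_ovl _ _ _
  · intro t _ t' _ h
    have key : ∀ (t : Fin n → Bool) (k : Fin n), t k = true ↔ n - (k : ℕ) ∈ T t := by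
      intro t k
      have hk := k.2
      simp only [T, Finset.mem_filter, Finset.mem_range]
      constructor
      · intro h; exact ⟨by omega, Or.inr ⟨k, h, by omega⟩⟩
      · rintro ⟨_, h | ⟨k', h, h'⟩⟩
        · omega
        · rwa [show k = k' from Fin.ext (by omega)]
    funext k
    rw [Bool.eq_iff_iff, key t k, key t' k]
    rw [h]

/-- Words of length `l` beginning and ending with `true`, without a run of `m` `false`s. -/
def Gd (w : ℕ → Bool) (l m : ℕ) : Prop :=
  1 ≤ l ∧ w 0 = true ∧ w (l - 1) = true ∧ ∀ i, i + m ≤ l → ∃ k, i ≤ k ∧ k < i + m ∧ w k = true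

def nw (w : ℕ → Bool) (l m : ℕ) : ℕ → Bool := fun i =>
  if i < l then w i else if i < l + m then false else w (i - (l + m))

theorem nw1 {w : ℕ → Bool} {l m i : ℕ} (h : i < l) : nw w l m i = w i := by simp [nw, h]
theorem nw2 {w : ℕ → Bool} {l m i : ℕ} (h : l ≤ i) (h' : i < l + m) : nw w l m i = false := by
  simp [nw, h', Nat.not_lt.2 h]
theorem nw3 {w : ℕ → Bool} {l m i : ℕ} : nw w l m (l + m + i) = w i := by
  have h1 : ¬ (l + m + i < l) := by omega
  have h2 : ¬ (l + m + i < l + m) := by omega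
  simp only [nw, h1, h2, if_false]
  congr 1; omega

theorem Gd_mono {w : ℕ → Bool} {l m m' : ℕ} (h : Gd w l m) (hm : m ≤ m') : Gd w l m' := by
  obtain ⟨h1, h2, h3, h4⟩ := h
  refine ⟨h1, h2, h3, fun i hi => ?_⟩
  obtain ⟨k, a, b, c⟩ := h4 i (by omega)
  exact ⟨k, a, by omega, c⟩

theorem Gd_nw {w : ℕ → Bool} {l m : ℕ} (h : Gd w l m) : Gd (nw w l m) (2 * l + m) (m + 1) := by
  obtain ⟨h1, h2, h3, h4⟩ := h
  refine ⟨by omega, ?_, ?_, fun i hi => ?_⟩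
  · rw [nw1 (by omega), h2]
  · rw [show 2 * l + m - 1 = l + m + (l - 1) by omega, nw3, h3]
  · by_cases hl : i < l
    · by_cases hw : l - 1 < i + (m + 1)
      · exact ⟨l - 1, by omega, hw, by rw [nw1 (by omega), h3]⟩
      · obtain ⟨k, a, b, c⟩ := h4 i (by omega)
        exact ⟨k, a, by omega, by rw [nw1 (by omega), c]⟩
    · by_cases hw : i ≤ l + m
      · exact ⟨l + m + 0, by omega, by omega, by rw [nw3, h2]⟩
      · obtain ⟨k, a, b, c⟩ := h4 (i - (l + m)) (by omega)
        exact ⟨l + m + k, by omega, by omega, by rw [nw3, c]⟩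

theorem ovl_nw {w : ℕ → Bool} {l m : ℕ} (h : Gd w l m) :
    ovl (2 * l + m) (nw w l m) (nw w l m) = insert (2 * l + m) (ovl l w w) := by
  obtain ⟨h1, h2, h3, h4⟩ := h
  ext b
  rw [Finset.mem_insert, mem_ovl, mem_ovl]
  constructor
  · rintro ⟨hb, hB⟩
    rcases Nat.eq_or_lt_of_le hb with h | hlt
    · exact Or.inl h
    right
    have hbl : b ≤ l := by
      by_contra hcon
      by_cases hc : b < l + m
      · have := hB 0 (by omega)
        rw [nw2 (by omega) (by omega), nw1 (by omega), h2] at this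
        exact absurd this (by simp)
      · by_cases hd : 2 * l + m - b ≤ m
        · have := hB (b - l) (by omega)
          rw [show 2 * l + m - b + (b - l) = l + m + 0 by omega, nw3, h2,
            nw2 (by omega) (by omega)] at this
          exact absurd this (by simp)
        · obtain ⟨k, a, b', c⟩ := h4 (2 * l - b) (by omega)
          have := hB (k + (l + m) - (2 * l + m - b)) (by omega)
          rw [show 2 * l + m - b + (k + (l + m) - (2 * l + m - b)) = l + m + k by omega, nw3, c,
            nw2 (by omega) (by omega)] at this
          exact absurd this (by simp)
    refine ⟨hbl, fun j hj => ?_⟩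
    have := hB j hj
    rwa [show 2 * l + m - b + j = l + m + (l - b + j) by omega, nw3, nw1 (by omega)] at this
  · rintro (rfl | ⟨hb, hB⟩)
    · exact ⟨le_rfl, fun j _ => by simp⟩
    · refine ⟨by omega, fun j hj => ?_⟩
      rw [show 2 * l + m - b + j = l + m + (l - b + j) by omega, nw3, nw1 (by omega)]
      exact hB j hj

def GG : ℕ → Finset (Finset ℕ)
  | 0 => {{0, 1}}
  | j + 1 => ((GG j) ×ˢ Finset.Ico (2 ^ j) (2 ^ (j + 1))).image
      (fun p => insert (2 * p.1.sup id + p.2) p.1)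

theorem sup_ovl (l : ℕ) (w : ℕ → Bool) : (ovl l w w).sup id = l := by
  apply le_antisymm
  · exact Finset.sup_le fun b hb => (mem_ovl.1 hb).1
  · exact Finset.le_sup (f := id) (mem_ovl.2 ⟨le_rfl, fun j _ => by simp⟩)

theorem GG_spec (j : ℕ) : ∀ B ∈ GG j, ∃ w l, ovl l w w = B ∧ l ≤ (j + 1) * 2 ^ j ∧
    Gd w l (2 ^ j) := by
  induction j with
  | zero =>
    intro B hB
    simp only [GG, Finset.mem_singleton] at hB
    refine ⟨fun _ => true, 1, ?_, by simp, by simp, rfl, rfl, fun i _ => ⟨i, by simp⟩⟩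
    rw [hB]; ext b
    simp [mem_ovl]; omega
  | succ j ih =>
    intro B hB
    simp only [GG, Finset.mem_image, Finset.mem_product, Finset.mem_Ico, Prod.exists] at hB
    obtain ⟨B', m, ⟨hB', hm1, hm2⟩, rfl⟩ := hB
    obtain ⟨w, l, rfl, hl, hg⟩ := ih B' hB'
    have hg' := Gd_mono hg hm1
    refine ⟨nw w l m, 2 * l + m, ?_, ?_, Gd_mono (Gd_nw hg') hm2⟩
    · rw [ovl_nw hg', sup_ovl]
    · have : (j + 1 + 1) * 2 ^ (j + 1) = 2 * ((j + 1) * 2 ^ j) + 2 ^ (j + 1) := by ring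
      omega

theorem GG_card (j : ℕ) : (GG j).card = 2 ^ (∑ i ∈ Finset.range j, i) := by
  induction j with
  | zero => simp [GG]
  | succ j ih =>
    rw [GG, Finset.card_image_of_injOn, Finset.card_product, ih, Finset.sum_range_succ,
      pow_add 2 _ j, Nat.card_Ico]
    · have : 2 ^ (j + 1) - 2 ^ j = 2 ^ j := by rw [pow_succ]; omega
      rw [this]
    · rintro ⟨B, m⟩ hB ⟨B', m'⟩ hB' h
      simp only [Finset.coe_product, Set.mem_prod, Finset.mem_coe, Finset.mem_Ico] at hB hB'
      obtain ⟨w, l, rfl, hl, hg⟩ := GG_spec j B hB.1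
      obtain ⟨w', l', rfl, hl', hg'⟩ := GG_spec j B' hB'.1
      have hp := Nat.two_pow_pos j
      simp only [sup_ovl] at h
      have hs : 2 * l + m = 2 * l' + m' := by
        have h1 : 2 * l + m ∈ insert (2 * l' + m') (ovl l' w' w') := by rw [← h]; simp
        have h2 : 2 * l' + m' ∈ insert (2 * l + m) (ovl l w w) := by rw [h]; simp
        rw [Finset.mem_insert, mem_ovl] at h1 h2
        omega
      have hBB : ovl l w w = ovl l' w' w' := by
        have e1 : 2 * l + m ∉ ovl l w w := by rw [mem_ovl]; omega
        have e2 : 2 * l' + m' ∉ ovl l' w' w' := by rw [mem_ovl]; omega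
        rw [← Finset.erase_insert e1, ← Finset.erase_insert e2, h, hs]
      have : l = l' := by rw [← sup_ovl l w, hBB, sup_ovl]
      simp only [Prod.mk.injEq]
      exact ⟨hBB, by omega⟩

theorem delta_lower (n J : ℕ) (hn : (2 * J + 3) * 2 ^ J ≤ n) :
    2 ^ (∑ i ∈ Finset.range J, i) ≤ (Delta n).ncard := by
  rw [← GG_card, ← Set.ncard_coe_finset]
  have hp := Nat.two_pow_pos J
  have hn' : 2 * ((J + 1) * 2 ^ J) + 2 ^ J ≤ n := by
    refine le_trans (le_of_eq ?_) hn; ring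
  refine Set.ncard_le_ncard_of_injOn
    (fun B => fun k : Fin n => decide (n - (k : ℕ) ∈ insert n B)) ?_ ?_ (Set.toFinite _)
  · intro B hB
    obtain ⟨w, l, rfl, hl, hg⟩ := GG_spec J B hB
    have hg' := Gd_mono hg (show 2 ^ J ≤ n - 2 * l by omega)
    have ho := ovl_nw hg'
    have e : 2 * l + (n - 2 * l) = n := by omega
    rw [e] at ho
    let u : Fin n → Bool := fun i => nw w l (n - 2 * l) i
    refine ⟨u, u, (isCorr_iff _ _ _ _).2 fun k => ?_⟩
    have hu : ∀ i < n, extw n u i = nw w l (n - 2 * l) i := by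
      intro i hi; simp [extw, hi, u]
    have ho' : ovl n (extw n u) (extw n u) = insert n (ovl l w w) := by
      rw [← ho]
      ext b
      rw [mem_ovl, mem_ovl]
      refine and_congr_right fun hb => forall_congr' fun j => imp_congr_right fun hj => ?_
      rw [hu _ (by omega), hu _ (by omega)]
    rw [ho', decide_eq_true_iff]
  · intro B hB B' hB' h
    obtain ⟨w, l, rfl, hl, hg⟩ := GG_spec J B hB
    obtain ⟨w', l', rfl, hl', hg'⟩ := GG_spec J B' hB'
    ext x
    by_cases hx : 0 < x ∧ x < n
    · have := congrFun h ⟨n - x, by omega⟩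
      simp only [decide_eq_decide, Finset.mem_insert] at this
      rw [show n - (n - x) = x by omega] at this
      have hxn : x ≠ n := by omega
      simpa [hxn] using this
    · rcases Nat.eq_zero_or_pos x with rfl | h0
      · exact ⟨fun _ => (CC_ovl _ _ _).1, fun _ => (CC_ovl _ _ _).1⟩
      · rw [mem_ovl, mem_ovl]
        constructor <;> rintro ⟨a, _⟩ <;> omega

theorem WW_bound (t : ℕ) (ht : 1 ≤ t) : Real.log (WW t) ≤
    (Real.log (2 * t)) ^ 2 / (2 * Real.log 2) + 2 * Real.log (2 * t) := by
  have hlam : 0 < Real.log 2 := Real.log_pos (by norm_num)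
  have hl3 : Real.log 3 ≤ 2 * Real.log 2 := by
    rw [← Real.log_rpow (by norm_num)]
    exact Real.log_le_log (by norm_num) (by norm_num)
  have hpos : ∀ t, 1 ≤ WW t := by
    intro t; rw [WW]; split_ifs <;> omega
  induction t using Nat.strong_induction_on with
  | _ t ih =>
  have hle : WW t ≤ 3 * t * WW (t / 2) := by
    rw [WW]
    simp only [show t ≠ 0 by omega, dite_false]
    have := hpos (t / 2)
    nlinarith
  have htR : (1 : ℝ) ≤ t := by exact_mod_cast ht
  have hW2 : (1 : ℝ) ≤ WW (t / 2) := by exact_mod_cast hpos (t / 2)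
  have h1 : Real.log (WW t) ≤ Real.log 3 + Real.log t + Real.log (WW (t / 2)) := by
    rw [← Real.log_mul (by norm_num) (by positivity), ← Real.log_mul (by positivity) (by positivity)]
    refine Real.log_le_log (by exact_mod_cast hpos t) ?_
    exact_mod_cast hle
  have hL : Real.log (2 * t) = Real.log 2 + Real.log t :=
    Real.log_mul (by norm_num) (by positivity)
  have ht0 : 0 ≤ Real.log t := Real.log_nonneg htR
  rw [hL]
  rcases Nat.eq_or_lt_of_le ht with h | h
  · subst h
    have : WW (1 / 2) = 1 := by rw [WW]; simp
    rw [this] at h1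
    simp at h1 ⊢
    have : 0 ≤ Real.log 2 ^ 2 / (2 * Real.log 2) := by positivity
    linarith
  · have h2 := ih (t / 2) (by omega) (by omega)
    have h3 : Real.log (2 * ((t / 2 : ℕ) : ℝ)) ≤ Real.log t := by
      refine Real.log_le_log ?_ ?_
      · have : 0 < t / 2 := by omega
        positivity
      · exact_mod_cast (by omega : 2 * (t / 2) ≤ t)
    have h4 : 0 ≤ Real.log (2 * ((t / 2 : ℕ) : ℝ)) := by
      refine Real.log_nonneg ?_
      exact_mod_cast (by omega : 1 ≤ 2 * (t / 2))
    have h5 : (Real.log (2 * ((t / 2 : ℕ) : ℝ))) ^ 2 / (2 * Real.log 2) ≤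
        (Real.log t) ^ 2 / (2 * Real.log 2) := by gcongr
    have h6 : (Real.log 2 + Real.log t) ^ 2 / (2 * Real.log 2) =
        Real.log 2 / 2 + Real.log t + (Real.log t) ^ 2 / (2 * Real.log 2) := by
      field_simp; ring
    rw [h6]
    linarith

theorem pow_bound (S : ℕ) (hS : 9 ≤ S) : 2 * (S + 1) ^ 2 + 3 ≤ 2 ^ S := by
  induction S, hS using Nat.le_induction with
  | base => norm_num
  | succ k hk ih =>
    rw [pow_succ 2 k]
    nlinarith

open Filter Topology in
theorem lower_tendsto : Tendsto (fun n : ℕ =>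
    (1 - ((Nat.sqrt (Nat.log 2 n) : ℝ) + 2) / ((Nat.sqrt (Nat.log 2 n) : ℝ) ^ 2 + 1)) ^ 2 *
      (1 / (2 * Real.log 2))) atTop (𝓝 (1 / (2 * Real.log 2))) := by
  have hS : Tendsto (fun n : ℕ => ((Nat.sqrt (Nat.log 2 n) : ℕ) : ℝ)) atTop atTop := by
    refine tendsto_natCast_atTop_atTop.comp ?_
    refine tendsto_atTop.2 fun b => ?_
    filter_upwards [eventually_ge_atTop (2 ^ (b * b))] with n hn
    rw [Nat.le_sqrt]
    exact Nat.le_log_of_pow_le (by norm_num) hn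
  have h1 : Tendsto (fun x : ℝ => (x + 2) / (x ^ 2 + 1)) atTop (𝓝 0) := by
    have hu : Tendsto (fun x : ℝ => 3 / x) atTop (𝓝 0) := tendsto_const_nhds.div_atTop tendsto_id
    refine squeeze_zero' ?_ ?_ hu
    · filter_upwards [eventually_ge_atTop 1] with x hx
      positivity
    · filter_upwards [eventually_ge_atTop 1] with x hx
      rw [div_le_div_iff₀ (by positivity) (by positivity)]
      nlinarith
  have h2 := h1.comp hS
  have h3 := (((tendsto_const_nhds (x := (1 : ℝ))).sub h2).pow 2).mul_const (1 / (2 * Real.log 2))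
  simpa using h3

open Filter Topology in
theorem upper_tendsto : Tendsto (fun n : ℕ =>
    (2 * Real.log n + ((Real.log 2 + Real.log n) ^ 2 / (2 * Real.log 2) +
      2 * (Real.log 2 + Real.log n))) / (Real.log n) ^ 2) atTop (𝓝 (1 / (2 * Real.log 2))) := by
  have hlam : 0 < Real.log 2 := Real.log_pos (by norm_num)
  have hl : Tendsto (fun n : ℕ => Real.log (n : ℝ)) atTop atTop :=
    Real.tendsto_log_atTop.comp tendsto_natCast_atTop_atTop
  have hi := tendsto_inv_atTop_zero.comp hl
  have h := ((tendsto_const_nhds (x := 1 / (2 * Real.log 2))).add (hi.const_mul 5)).add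
    ((hi.pow 2).const_mul (5 / 2 * Real.log 2))
  simp only [mul_zero, add_zero, ne_eq, OfNat.ofNat_ne_zero, not_false_eq_true, zero_pow] at h
  refine h.congr' ?_
  filter_upwards [hl.eventually_gt_atTop 0] with n hn
  simp only [Function.comp]
  field_simp
  ring

theorem delta_asymptotics :
    Filter.Tendsto (fun n : ℕ => Real.log ((Delta n).ncard) / (Real.log n) ^ 2)
      Filter.atTop (nhds (1 / (2 * Real.log 2))) := by
  have hlam : 0 < Real.log 2 := Real.log_pos (by norm_num)
  refine tendsto_of_tendsto_of_tendsto_of_le_of_le' lower_tendsto upper_tendsto ?_ ?_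
  · filter_upwards [Filter.eventually_ge_atTop (2 ^ 100)] with n hn
    set L := Nat.log 2 n with hL
    set S := Nat.sqrt L with hSdef
    have hLn : 100 ≤ L := Nat.le_log_of_pow_le (by norm_num) hn
    have hS : 9 ≤ S := Nat.le_sqrt.2 (by omega)
    have hSL : S * S ≤ L := Nat.sqrt_le L
    have hLS : L < (S + 1) * (S + 1) := Nat.sqrt_lt.1 (Nat.lt_succ_self _)
    have hSL' : S + 1 ≤ L := by nlinarith
    obtain ⟨J, hJ⟩ : ∃ J, L = J + 1 + S := ⟨L - S - 1, by omega⟩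
    have hnpos : n ≠ 0 := by
      have := Nat.two_pow_pos 100; omega
    have h1 : 2 ^ L ≤ n := Nat.pow_log_le_self 2 hnpos
    have h2 : n < 2 ^ (L + 1) := Nat.lt_pow_succ_log_self (by norm_num) n
    have h3 := pow_bound S hS
    have hlow := delta_lower n (J + 1) (by
      refine le_trans ?_ h1
      rw [hJ, pow_add 2 (J + 1) S, mul_comm]
      refine Nat.mul_le_mul_left _ ?_
      nlinarith)
    have hsum : J ^ 2 ≤ 2 * ∑ i ∈ Finset.range (J + 1), i := by
      rw [mul_comm, Finset.sum_range_id_mul_two]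
      simp; nlinarith
    set E := ∑ i ∈ Finset.range (J + 1), i
    have h4 : (E : ℝ) * Real.log 2 ≤ Real.log ((Delta n).ncard) := by
      rw [← Real.log_pow]
      refine Real.log_le_log (by positivity) ?_
      exact_mod_cast hlow
    have h5 : Real.log n ≤ (L + 1) * Real.log 2 := by
      have : Real.log ((2 : ℝ) ^ (L + 1)) = (L + 1) * Real.log 2 := by
        rw [Real.log_pow]; push_cast; ring
      rw [← this]
      refine Real.log_le_log (by positivity) ?_
      exact_mod_cast h2.le
    have h6 : 0 < Real.log n := by
      refine Real.log_pos ?_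
      have : 1 < n := lt_of_lt_of_le (by norm_num) hn
      exact_mod_cast this
    have hsumR : (J : ℝ) ^ 2 ≤ 2 * E := by exact_mod_cast hsum
    have hSLR : (S : ℝ) ^ 2 ≤ L := by rw [sq]; exact_mod_cast hSL
    have hJR : (L : ℝ) = J + 1 + S := by exact_mod_cast hJ
    have hSR : (9 : ℝ) ≤ S := by exact_mod_cast hS
    have hJ0 : (0 : ℝ) ≤ J := Nat.cast_nonneg _
    rw [le_div_iff₀ (by positivity)]
    have hb : 1 - ((S : ℝ) + 2) / ((S : ℝ) ^ 2 + 1) ≤ J / (L + 1) := by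
      have : (J : ℝ) / (L + 1) = 1 - (S + 2) / (L + 1) := by
        have : (L : ℝ) + 1 ≠ 0 := by positivity
        field_simp; linarith
      rw [this]
      gcongr
    have hb0 : 0 ≤ 1 - ((S : ℝ) + 2) / ((S : ℝ) ^ 2 + 1) := by
      rw [sub_nonneg, div_le_one (by positivity)]
      nlinarith
    calc (1 - ((S : ℝ) + 2) / ((S : ℝ) ^ 2 + 1)) ^ 2 * (1 / (2 * Real.log 2)) * Real.log n ^ 2
        ≤ (J / (L + 1)) ^ 2 * (1 / (2 * Real.log 2)) * ((L + 1) * Real.log 2) ^ 2 := by gcongr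
      _ = J ^ 2 / 2 * Real.log 2 := by
        have : (L : ℝ) + 1 ≠ 0 := by positivity
        field_simp
      _ ≤ E * Real.log 2 := by
        refine mul_le_mul_of_nonneg_right ?_ hlam.le
        linarith
      _ ≤ _ := h4
  · filter_upwards [Filter.eventually_ge_atTop 2] with n hn
    have hnR : (2 : ℝ) ≤ n := by exact_mod_cast hn
    have hn0 : 0 < Real.log n := Real.log_pos (by linarith)
    refine div_le_div_of_nonneg_right ?_ (by positivity)
    have hW := WW_bound n (by omega)
    rw [Real.log_mul (by norm_num) (by positivity)] at hW
    have hup := delta_upper n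
    have hWpos : 1 ≤ WW n := by rw [WW]; split_ifs <;> omega
    have hWR : (1 : ℝ) ≤ WW n := by exact_mod_cast hWpos
    have h1 : Real.log ((Delta n).ncard) ≤ Real.log ((n : ℝ) ^ 2 * WW n) := by
      rcases Nat.eq_zero_or_pos (Delta n).ncard with h0 | h0
      · rw [h0]; simp only [Nat.cast_zero, Real.log_zero]
        exact Real.log_nonneg (by nlinarith)
      · refine Real.log_le_log (by exact_mod_cast h0) ?_
        have : (Delta n).ncard ≤ n ^ 2 * WW n :=
          hup.trans (Nat.mul_le_mul_right _ (by nlinarith))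
        exact_mod_cast this
    rw [Real.log_mul (by positivity) (by positivity), Real.log_pow] at h1
    push_cast at h1
    linarith
end
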